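/- arXiv:1204.3963 — 3 statements merged into one kernel-verified Lean document; each statement's English description precedes it below -/
import Mathlib

section
/- (Flat bound for the maximal function) Let 1 < p < ∞ and let n ≥ 1. There exist constants δ_{n,p} > 0 and c_{n,p} > 0, depending only on the dimension n and on p, such that for every weight w ∈ A_p on ℝⁿ with [w]_{A_p} ≤ 1 + δ_{n,p}, ‖M‖_{L^p(w)→L^p(w)} ≤ ‖M‖_{L^p→L^p}·(1 + c_{n,p}·√([w]_{A_p} − 1)), where ‖M‖_{L^p→L^p} is the operator norm of M on the unweighted space L^p(ℝⁿ). -/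
open MeasureTheory Set Filter ENNReal

noncomputable section

/-- An axis-parallel cube in `ℝⁿ` with positive side length. -/
def IsCube {n : ℕ} (Q : Set (Fin n → ℝ)) : Prop :=
  ∃ (a : Fin n → ℝ) (r : ℝ), 0 < r ∧ Q = Set.Icc a (fun i => a i + r)

/-- The average `|Q|⁻¹ ∫_Q f dx` (of the nonnegative part of `f`), as a value in `ℝ≥0∞`. -/
def avg {n : ℕ} (Q : Set (Fin n → ℝ)) (f : (Fin n → ℝ) → ℝ) : ℝ≥0∞ :=
  (∫⁻ x in Q, ENNReal.ofReal (f x)) / volume Q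

/-- A weight on `ℝⁿ`: a positive (almost everywhere) locally integrable function. -/
def IsWeight {n : ℕ} (w : (Fin n → ℝ) → ℝ) : Prop :=
  (∀ᵐ x ∂(volume : Measure (Fin n → ℝ)), 0 < w x) ∧ LocallyIntegrable w volume

/-- The `A_p` characteristic `sup_Q (|Q|⁻¹∫_Q w)(|Q|⁻¹∫_Q w^{-1/(p-1)})^{p-1}`,
as a value in `ℝ≥0∞`. -/
def apCharE {n : ℕ} (p : ℝ) (w : (Fin n → ℝ) → ℝ) : ℝ≥0∞ :=
  ⨆ (Q : Set (Fin n → ℝ)) (_ : IsCube Q),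
    avg Q w * (avg Q (fun x => w x ^ (-(1 / (p - 1))))) ^ (p - 1)

/-- The `A_p` characteristic of `w`, as a real number. -/
def apChar {n : ℕ} (p : ℝ) (w : (Fin n → ℝ) → ℝ) : ℝ :=
  (apCharE p w).toReal

/-- Membership in the Muckenhoupt class `A_p`: `w` is a weight with finite `A_p`
characteristic. -/
def MemAp {n : ℕ} (p : ℝ) (w : (Fin n → ℝ) → ℝ) : Prop :=
  IsWeight w ∧ apCharE p w ≠ ⊤

/-- The non-centered Hardy–Littlewood maximal function (`ℝ≥0∞`-valued):
`Mf(x) = sup_{Q ∋ x} |Q|⁻¹ ∫_Q |f|`. -/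
def maximalE {n : ℕ} (f : (Fin n → ℝ) → ℝ) (x : Fin n → ℝ) : ℝ≥0∞ :=
  ⨆ (Q : Set (Fin n → ℝ)) (_ : IsCube Q) (_ : x ∈ Q), avg Q (fun y => |f y|)

/-- The non-centered Hardy–Littlewood maximal function, real-valued. -/
def maximal {n : ℕ} (f : (Fin n → ℝ) → ℝ) (x : Fin n → ℝ) : ℝ :=
  (maximalE f x).toReal

/-- The norm `(∫ |f|^p w dx)^{1/p}` of `f` in `L^p(w)`, as a value in `ℝ≥0∞`. -/
def eLpNormW {n : ℕ} (p : ℝ) (w f : (Fin n → ℝ) → ℝ) : ℝ≥0∞ :=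
  (∫⁻ x, ENNReal.ofReal (|f x| ^ p) * ENNReal.ofReal (w x)) ^ (1 / p)

/-- Membership in `L^p(w)`: `f` is measurable with finite `L^p(w)` norm. -/
def MemLpW {n : ℕ} (p : ℝ) (w f : (Fin n → ℝ) → ℝ) : Prop :=
  Measurable f ∧ eLpNormW p w f ≠ ⊤

/-- `T` is (strongly) bounded on `L^p(w)` with constant `c`:
`‖Tf‖_{L^p(w)} ≤ c ‖f‖_{L^p(w)}` for all `f ∈ L^p(w)`. -/
def StrongBound {n : ℕ} (p : ℝ) (w : (Fin n → ℝ) → ℝ)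
    (T : ((Fin n → ℝ) → ℝ) → (Fin n → ℝ) → ℝ) (c : ℝ) : Prop :=
  ∀ f, MemLpW p w f → eLpNormW p w (T f) ≤ ENNReal.ofReal c * eLpNormW p w f

/-- The operator norm of `T` on `L^p(w)`: the least constant in a strong bound. -/
def opNorm {n : ℕ} (p : ℝ) (w : (Fin n → ℝ) → ℝ)
    (T : ((Fin n → ℝ) → ℝ) → (Fin n → ℝ) → ℝ) : ℝ :=
  sInf { c : ℝ | 0 ≤ c ∧ StrongBound p w T c }

/-- The `w`-measure `w(E) = ∫_E w dx` of a set `E`. -/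
def wMeasure {n : ℕ} (w : (Fin n → ℝ) → ℝ) (E : Set (Fin n → ℝ)) : ℝ≥0∞ :=
  ∫⁻ x in E, ENNReal.ofReal (w x)

/-- `T` is of weak type `(p,p)` with respect to `w`, with constant `c`:
`λ · w({|Tf| > λ})^{1/p} ≤ c ‖f‖_{L^p(w)}` for all `λ > 0` and `f ∈ L^p(w)`. -/
def WeakBound {n : ℕ} (p : ℝ) (w : (Fin n → ℝ) → ℝ)
    (T : ((Fin n → ℝ) → ℝ) → (Fin n → ℝ) → ℝ) (c : ℝ) : Prop :=
  ∀ f, MemLpW p w f → ∀ lam : ℝ, 0 < lam →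
    ENNReal.ofReal lam * wMeasure w {x | lam < |T f x|} ^ (1 / p)
      ≤ ENNReal.ofReal c * eLpNormW p w f

/-- The weak-type `(p,p)` norm `‖T‖_{L^p(w) → L^{p,∞}(w)}`: the least constant in a
weak bound. -/
def weakNorm {n : ℕ} (p : ℝ) (w : (Fin n → ℝ) → ℝ)
    (T : ((Fin n → ℝ) → ℝ) → (Fin n → ℝ) → ℝ) : ℝ :=
  sInf { c : ℝ | 0 ≤ c ∧ WeakBound p w T c }

/-- Membership in `A₁`: `u` is a weight with `Mu ≤ c·u` a.e. for some `c`. -/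
def MemA1 {n : ℕ} (u : (Fin n → ℝ) → ℝ) : Prop :=
  IsWeight u ∧ ∃ c : ℝ, ∀ᵐ x ∂(volume : Measure (Fin n → ℝ)),
    maximalE u x ≤ ENNReal.ofReal (c * u x)

/-- The `A₁` characteristic of `u`: the least `c` with `Mu ≤ c·u` a.e. -/
def a1Char {n : ℕ} (u : (Fin n → ℝ) → ℝ) : ℝ :=
  sInf { c : ℝ | ∀ᵐ x ∂(volume : Measure (Fin n → ℝ)),
    maximalE u x ≤ ENNReal.ofReal (c * u x) }

/-- The dual maximal operator `M'f = M(fw)/w`. -/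
def dualMax {n : ℕ} (w : (Fin n → ℝ) → ℝ) (f : (Fin n → ℝ) → ℝ)
    (x : Fin n → ℝ) : ℝ :=
  maximal (fun y => f y * w y) x / w x

/-- half-open cube -/
def hc {n : ℕ} (a : Fin n → ℝ) (r : ℝ) : Set (Fin n → ℝ) :=
  Set.univ.pi fun i => Set.Ico (a i) (a i + r)

def hmean {n : ℕ} (ψ : (Fin n → ℝ) → ℝ) (a : Fin n → ℝ) (r : ℝ) : ℝ :=
  (∫ x in hc a r, ψ x) / r ^ n

def child {n : ℕ} (a : Fin n → ℝ) (r : ℝ) (b : Fin n → Bool) : Fin n → ℝ :=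
  fun i => a i + (if b i then r / 2 else 0)

def bits {n : ℕ} (a : Fin n → ℝ) (r : ℝ) (x : Fin n → ℝ) : Fin n → Bool :=
  fun i => decide (a i + r / 2 ≤ x i)

lemma measurableSet_hc {n : ℕ} (a : Fin n → ℝ) (r : ℝ) : MeasurableSet (hc a r) :=
  MeasurableSet.univ_pi fun _ => measurableSet_Ico

lemma hc_ae_eq {n : ℕ} (a : Fin n → ℝ) (r : ℝ) :
    hc a r =ᵐ[volume] Set.Icc a (fun i => a i + r) := by
  have := Measure.univ_pi_Ico_ae_eq_Icc (μ := fun _ : Fin n => (volume : Measure ℝ))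
    (f := a) (g := fun i => a i + r)
  exact this

lemma volume_cube {n : ℕ} (a : Fin n → ℝ) {r : ℝ} (hr : 0 < r) :
    volume (Set.Icc a (fun i => a i + r)) = ENNReal.ofReal (r ^ n) := by
  rw [Real.volume_Icc_pi]
  simp [ENNReal.ofReal_pow hr.le]

lemma volume_hc {n : ℕ} (a : Fin n → ℝ) {r : ℝ} (hr : 0 < r) :
    volume (hc a r) = ENNReal.ofReal (r ^ n) := by
  rw [measure_congr (hc_ae_eq a r), volume_cube a hr]

lemma mem_child {n : ℕ} {a : Fin n → ℝ} {r : ℝ} (hr : 0 < r) (b : Fin n → Bool) (x : Fin n → ℝ) :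
    x ∈ hc (child a r b) (r / 2) ↔ x ∈ hc a r ∧ bits a r x = b := by
  simp only [hc, Set.mem_univ_pi, child, bits, funext_iff, ← forall_and, Set.mem_Ico]
  refine forall_congr' fun i => ?_
  cases b i <;> simp
  · intro h1 h2; linarith
  · constructor
    · rintro ⟨h1, h2⟩; exact ⟨⟨by linarith, by linarith⟩, h1⟩
    · rintro ⟨⟨h1, h2⟩, h3⟩; exact ⟨h3, by linarith⟩

lemma hc_eq_iUnion {n : ℕ} (a : Fin n → ℝ) {r : ℝ} (hr : 0 < r) :
    hc a r = ⋃ b, hc (child a r b) (r / 2) := by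
  ext x
  simp [mem_child hr]

lemma disj_child {n : ℕ} (a : Fin n → ℝ) {r : ℝ} (hr : 0 < r) :
    Pairwise (Function.onFun Disjoint fun b => hc (child a r b) (r / 2)) := by
  intro b c hbc
  refine Set.disjoint_left.2 fun x hx hy => hbc ?_
  rw [mem_child hr] at hx hy
  rw [← hx.2, hy.2]

lemma card_bits (n : ℕ) : (Fintype.card (Fin n → Bool) : ℝ) = 2 ^ n := by simp

lemma hmean_child {n : ℕ} {ψ : (Fin n → ℝ) → ℝ} (a : Fin n → ℝ) {r : ℝ} (hr : 0 < r)
    (h : ∀ a r, 0 < r → IntegrableOn ψ (hc a r)) :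
    ∑ b, hmean ψ (child a r b) (r / 2) = 2 ^ n * hmean ψ a r := by
  unfold hmean
  rw [hc_eq_iUnion a hr, integral_iUnion_fintype (fun b => measurableSet_hc _ _) (disj_child a hr)
    (fun b => h _ _ (by linarith)), ← Finset.sum_div, div_pow]
  field_simp

/-- the pointwise Bellman inequality -/
lemma bellman_pt {d m u : ℝ} (hd : d ^ 2 ≤ 1 / 16) (hm0 : 0 ≤ m) (hm : m ≤ 1 / 16)
    (hu0 : 0 ≤ m + u) (hu : m + u ≤ 1 / 16) :
    Real.exp d * (1 + 4 * (m + u) - 16 * (m + u) ^ 2) ≤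
      (1 + 4 * m - 16 * m ^ 2) + d * (1 + 4 * m - 16 * m ^ 2) + (4 - 32 * m) * u + 2 * d ^ 2 := by
  have hd' : |d| ≤ 1 / 4 := abs_le_of_sq_le_sq (by nlinarith) (by norm_num)
  have h1 := (abs_le.1 (Real.abs_exp_sub_one_sub_id_le (x := d) (by linarith))).2
  have hg : 0 ≤ 1 + 4 * (m + u) - 16 * (m + u) ^ 2 := by nlinarith
  have hg1 : 1 + 4 * (m + u) - 16 * (m + u) ^ 2 ≤ 5 / 4 := by nlinarith
  have h2 : Real.exp d * (1 + 4 * (m + u) - 16 * (m + u) ^ 2) ≤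
      (1 + d + d ^ 2) * (1 + 4 * (m + u) - 16 * (m + u) ^ 2) :=
    mul_le_mul_of_nonneg_right (by linarith) hg
  refine h2.trans ?_
  have h3 : d ^ 2 * (1 + 4 * (m + u) - 16 * (m + u) ^ 2) ≤ d ^ 2 * (5 / 4) :=
    mul_le_mul_of_nonneg_left hg1 (sq_nonneg _)
  have h4 : (4 - 32 * m) * (d * u) ≤ 8 * u ^ 2 + d ^ 2 / 2 := by
    have hc0 : 0 ≤ 4 - 32 * m := by linarith
    have hc1 : 4 - 32 * m ≤ 4 := by linarith
    have : d * u ≤ |d * u| := le_abs_self _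
    have h5 : |d * u| ≤ 2 * u ^ 2 + d ^ 2 / 8 := by
      rw [abs_le]; constructor <;> nlinarith [sq_nonneg (4 * u - d), sq_nonneg (4 * u + d)]
    calc (4 - 32 * m) * (d * u) ≤ (4 - 32 * m) * |d * u| := mul_le_mul_of_nonneg_left this hc0
      _ ≤ 4 * |d * u| := mul_le_mul_of_nonneg_right hc1 (abs_nonneg _)
      _ ≤ _ := by linarith
  have h6 : - (16 * d * u ^ 2) ≤ 4 * u ^ 2 := by
    nlinarith [sq_nonneg u, (abs_le.1 hd').1]
  nlinarith [sq_nonneg u, sq_nonneg d]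

/-- the summed Bellman inequality -/
lemma bellman_sum {ι : Type*} [Fintype ι] {N : ℝ} (hN : (Fintype.card ι : ℝ) = N) (hN0 : 0 < N)
    {x y : ℝ} {X Y : ι → ℝ} (hX : ∑ i, X i = N * x) (hY : ∑ i, Y i = N * y)
    (h0 : ∀ i, X i ^ 2 ≤ Y i) (h1 : ∀ i, Y i - X i ^ 2 ≤ 1 / 16) (h2 : y - x ^ 2 ≤ 1 / 16)
    (h3 : N * (y - x ^ 2) ≤ 1 / 16) :
    ∑ i, Real.exp (X i) * (1 + 4 * (Y i - X i ^ 2) - 16 * (Y i - X i ^ 2) ^ 2) ≤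
      N * (Real.exp x * (1 + 4 * (y - x ^ 2) - 16 * (y - x ^ 2) ^ 2)) := by
  set D : ℝ := (∑ i, (X i - x) ^ 2) / N with hD
  set m : ℝ := (∑ i, (Y i - X i ^ 2)) / N with hm
  have hND : ∑ i, (X i - x) ^ 2 = N * D := by rw [hD]; field_simp
  have hNm : ∑ i, (Y i - X i ^ 2) = N * m := by rw [hm]; field_simp
  have hsq : ∑ i, (X i - x) ^ 2 = ∑ i, X i ^ 2 - N * x ^ 2 := by
    have : ∀ i, (X i - x) ^ 2 = X i ^ 2 - 2 * x * X i + x ^ 2 := fun i => by ring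
    simp only [this, Finset.sum_add_distrib, Finset.sum_sub_distrib, ← Finset.mul_sum, hX]
    simp [hN]; ring
  have hmD : m + D = y - x ^ 2 := by
    have : N * (m + D) = N * (y - x ^ 2) := by
      rw [mul_add, ← hNm, ← hND, hsq, Finset.sum_sub_distrib, hY]; ring
    exact mul_left_cancel₀ hN0.ne' this
  have hD0 : 0 ≤ D := div_nonneg (Finset.sum_nonneg fun i _ => sq_nonneg _) hN0.le
  have hm0 : 0 ≤ m := div_nonneg (Finset.sum_nonneg fun i _ => by linarith [h0 i]) hN0.le
  have hd : ∀ i, (X i - x) ^ 2 ≤ 1 / 16 := by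
    intro i
    have : (X i - x) ^ 2 ≤ ∑ i, (X i - x) ^ 2 :=
      Finset.single_le_sum (f := fun i => (X i - x) ^ 2) (fun i _ => sq_nonneg _)
        (Finset.mem_univ i)
    have h4 : N * D ≤ N * (y - x ^ 2) := mul_le_mul_of_nonneg_left (by linarith) hN0.le
    linarith
  have key : ∀ i, Real.exp (X i) * (1 + 4 * (Y i - X i ^ 2) - 16 * (Y i - X i ^ 2) ^ 2) ≤
      Real.exp x * ((1 + 4 * m - 16 * m ^ 2) + (X i - x) * (1 + 4 * m - 16 * m ^ 2)
        + (4 - 32 * m) * ((Y i - X i ^ 2) - m) + 2 * (X i - x) ^ 2) := by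
    intro i
    have := bellman_pt (d := X i - x) (m := m) (u := (Y i - X i ^ 2) - m) (hd i) hm0
      (by linarith) (by linarith [h0 i]) (by linarith [h1 i])
    have e : Real.exp (X i) = Real.exp x * Real.exp (X i - x) := by
      rw [← Real.exp_add]; ring_nf
    rw [e, mul_assoc]
    refine mul_le_mul_of_nonneg_left ?_ (Real.exp_pos _).le
    rwa [add_sub_cancel] at this
  refine (Finset.sum_le_sum fun i _ => key i).trans ?_
  rw [← Finset.mul_sum]
  have : ∑ i, ((1 + 4 * m - 16 * m ^ 2) + (X i - x) * (1 + 4 * m - 16 * m ^ 2)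
        + (4 - 32 * m) * ((Y i - X i ^ 2) - m) + 2 * (X i - x) ^ 2)
      = N * (1 + 4 * m - 16 * m ^ 2) + 2 * (N * D) := by
    simp only [Finset.sum_add_distrib, ← Finset.mul_sum, ← Finset.sum_mul, hND]
    rw [Finset.sum_sub_distrib (f := X), Finset.sum_sub_distrib (f := fun i => Y i - X i ^ 2),
      hX, hNm]
    simp [hN]
    try ring
  rw [this, ← hmD]
  have h5 : (1 + 4 * m - 16 * m ^ 2) + 2 * D ≤ 1 + 4 * (m + D) - 16 * (m + D) ^ 2 := by
    nlinarith
  have := mul_le_mul_of_nonneg_left h5 (mul_pos hN0 (Real.exp_pos x)).le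
  nlinarith

def TT {n : ℕ} (ψ : (Fin n → ℝ) → ℝ) : ℕ → (Fin n → ℝ) → ℝ → (Fin n → ℝ) → ℝ≥0∞
  | 0, a, r, _ => ENNReal.ofReal (Real.exp (hmean ψ a r))
  | k + 1, a, r, x => TT ψ k (child a r (bits a r x)) (r / 2) x

lemma measurable_bits {n : ℕ} (a : Fin n → ℝ) (r : ℝ) : Measurable (bits a r) := by
  refine measurable_pi_lambda _ fun i => ?_
  have : MeasurableSet {x : Fin n → ℝ | a i + r / 2 ≤ x i} :=
    measurableSet_le measurable_const (measurable_pi_apply i)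
  refine measurable_to_bool ?_
  convert this using 1
  ext x; simp [bits]

lemma measurable_TT {n : ℕ} (ψ : (Fin n → ℝ) → ℝ) (k : ℕ) :
    ∀ a r, Measurable (TT ψ k a r) := by
  induction k with
  | zero => intro a r; exact measurable_const
  | succ k ih =>
    intro a r
    have h : Measurable fun q : (Fin n → Bool) × (Fin n → ℝ) =>
        TT ψ k (child a r q.1) (r / 2) q.2 :=
      measurable_from_prod_countable_right fun b => ih (child a r b) (r / 2)
    exact h.comp ((measurable_bits a r).prodMk measurable_id)

lemma TT_spec {n : ℕ} (ψ : (Fin n → ℝ) → ℝ) (k : ℕ) :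
    ∀ a r x, 0 < r → x ∈ hc a r → ∃ a', x ∈ hc a' (r / 2 ^ k) ∧
      TT ψ k a r x = ENNReal.ofReal (Real.exp (hmean ψ a' (r / 2 ^ k))) := by
  induction k with
  | zero => intro a r x hr hx; exact ⟨a, by simpa using hx, by simp [TT]⟩
  | succ k ih =>
    intro a r x hr hx
    obtain ⟨a', h1, h2⟩ := ih (child a r (bits a r x)) (r / 2) x (by linarith)
      ((mem_child hr _ _).2 ⟨hx, rfl⟩)
    have e : r / 2 / 2 ^ k = r / 2 ^ (k + 1) := by rw [pow_succ]; field_simp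
    rw [e] at h1 h2
    exact ⟨a', h1, h2⟩

lemma hmean_sq_le {n : ℕ} {ψ : (Fin n → ℝ) → ℝ} {a : Fin n → ℝ} {r : ℝ} (hr : 0 < r)
    (h1 : IntegrableOn ψ (hc a r)) (h2 : IntegrableOn (fun x => ψ x ^ 2) (hc a r)) :
    hmean ψ a r ^ 2 ≤ hmean (fun x => ψ x ^ 2) a r := by
  set c := hmean ψ a r with hc'
  have hrn : 0 < r ^ n := pow_pos hr n
  have hfin : volume (hc a r) ≠ ⊤ := by rw [volume_hc a hr]; exact ENNReal.ofReal_ne_top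
  have hitg : ∫ x in hc a r, ψ x = c * r ^ n := by rw [hc', hmean]; field_simp
  have h0 : 0 ≤ ∫ x in hc a r, (ψ x - c) ^ 2 := integral_nonneg fun x => sq_nonneg _
  have e : ∫ x in hc a r, (ψ x - c) ^ 2 = (∫ x in hc a r, ψ x ^ 2) - c ^ 2 * r ^ n := by
    have : (fun x => (ψ x - c) ^ 2) = fun x => ψ x ^ 2 - 2 * c * ψ x + c ^ 2 := by
      ext x; ring
    have hconst : IntegrableOn (fun _ : Fin n → ℝ => c ^ 2) (hc a r) := integrableOn_const hfin
    have h3 : IntegrableOn (fun x => 2 * c * ψ x) (hc a r) := h1.const_mul _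
    have h4 : IntegrableOn (fun x => ψ x ^ 2 - 2 * c * ψ x) (hc a r) := h2.sub h3
    rw [this, integral_add h4 hconst, integral_sub h2 h3, integral_const_mul, hitg]
    simp [Measure.real, volume_hc a hr, ENNReal.toReal_ofReal hrn.le]
    ring
  rw [e] at h0
  rw [show hmean (fun x => ψ x ^ 2) a r = (∫ x in hc a r, ψ x ^ 2) / r ^ n from rfl,
    le_div_iff₀ hrn]
  linarith

def gV (x y : ℝ) : ℝ := Real.exp x * (1 + 4 * (y - x ^ 2) - 16 * (y - x ^ 2) ^ 2)

lemma TT_bound {n : ℕ} {ψ : (Fin n → ℝ) → ℝ}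
    (h1 : ∀ a r, 0 < r → IntegrableOn ψ (hc a r))
    (h2 : ∀ a r, 0 < r → IntegrableOn (fun x => ψ x ^ 2) (hc a r))
    (hv : ∀ a r, 0 < r → 2 ^ n * (hmean (fun x => ψ x ^ 2) a r - hmean ψ a r ^ 2) ≤ 1 / 16)
    (k : ℕ) : ∀ a r, 0 < r → ∫⁻ x in hc a r, TT ψ k a r x ≤
      ENNReal.ofReal (r ^ n * gV (hmean ψ a r) (hmean (fun x => ψ x ^ 2) a r)) := by
  have hv' : ∀ a r, 0 < r → hmean (fun x => ψ x ^ 2) a r - hmean ψ a r ^ 2 ≤ 1 / 16 := by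
    intro a r hr
    have := hv a r hr
    have h3 := hmean_sq_le hr (h1 a r hr) (h2 a r hr)
    have : (1 : ℝ) ≤ 2 ^ n := one_le_pow₀ (by norm_num)
    nlinarith
  induction k with
  | zero =>
    intro a r hr
    have hrn : 0 < r ^ n := pow_pos hr n
    simp only [TT, lintegral_const, Measure.restrict_apply_univ, volume_hc a hr]
    rw [← ENNReal.ofReal_mul (Real.exp_pos _).le]
    refine ENNReal.ofReal_le_ofReal ?_
    rw [mul_comm, gV]
    refine mul_le_mul_of_nonneg_left ?_ hrn.le
    have h3 := hmean_sq_le hr (h1 a r hr) (h2 a r hr)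
    refine le_mul_of_one_le_right (Real.exp_pos _).le ?_
    nlinarith [hv' a r hr]
  | succ k ih =>
    intro a r hr
    have hr2 : 0 < r / 2 := by linarith
    have e : ∫⁻ x in hc a r, TT ψ (k + 1) a r x =
        ∑ b, ∫⁻ x in hc (child a r b) (r / 2), TT ψ k (child a r b) (r / 2) x := by
      conv_lhs => rw [hc_eq_iUnion a hr]
      rw [lintegral_iUnion (fun b => measurableSet_hc _ _) (disj_child a hr), tsum_fintype]
      refine Finset.sum_congr rfl fun b _ => setLIntegral_congr_fun (measurableSet_hc _ _) ?_
      intro x hx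
      have := ((mem_child hr _ _).1 hx).2
      simp only [TT, this]
    rw [e]
    refine (Finset.sum_le_sum fun b _ => ih (child a r b) (r / 2) hr2).trans ?_
    have hpos : ∀ b, 0 ≤ gV (hmean ψ (child a r b) (r / 2))
        (hmean (fun x => ψ x ^ 2) (child a r b) (r / 2)) := by
      intro b
      have h3 := hmean_sq_le hr2 (h1 (child a r b) _ hr2) (h2 (child a r b) _ hr2)
      have h4 := hv' (child a r b) _ hr2
      refine mul_nonneg (Real.exp_pos _).le ?_
      nlinarith
    rw [← ENNReal.ofReal_sum_of_nonneg (fun b _ => mul_nonneg (pow_pos hr2 n).le (hpos b))]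
    refine ENNReal.ofReal_le_ofReal ?_
    rw [← Finset.mul_sum]
    have := bellman_sum (card_bits n) (by positivity) (hmean_child a hr h1)
      (hmean_child a hr h2)
      (fun b => hmean_sq_le hr2 (h1 (child a r b) _ hr2) (h2 (child a r b) _ hr2))
      (fun b => hv' (child a r b) _ hr2) (hv' a r hr) (hv a r hr)
    calc _ ≤ (r / 2) ^ n * (2 ^ n * gV (hmean ψ a r) (hmean (fun x => ψ x ^ 2) a r)) :=
          mul_le_mul_of_nonneg_left this (pow_pos hr2 n).le
      _ = _ := by rw [div_pow]; field_simp

lemma cube_eq_ball {n : ℕ} (a : Fin n → ℝ) {r : ℝ} (hr : 0 < r) :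
    Set.Icc a (fun i => a i + r) = Metric.closedBall (fun i => a i + r / 2) (r / 2) := by
  ext x
  rw [closedBall_pi _ (by linarith), ← Set.pi_univ_Icc]
  simp only [Set.mem_univ_pi, Real.closedBall_eq_Icc, Set.mem_Icc]
  refine forall_congr' fun i => ?_
  constructor <;> rintro ⟨h1, h2⟩ <;> constructor <;> linarith

lemma hmean_eq_average {n : ℕ} (ψ : (Fin n → ℝ) → ℝ) (a : Fin n → ℝ) {r : ℝ} (hr : 0 < r) :
    hmean ψ a r = ⨍ x in Metric.closedBall (fun i => a i + r / 2) (r / 2), ψ x := by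
  rw [setAverage_eq, ← cube_eq_ball a hr, Measure.real, volume_cube a hr,
    ENNReal.toReal_ofReal (pow_pos hr n).le, hmean, setIntegral_congr_set (hc_ae_eq a r)]
  rw [smul_eq_mul, div_eq_inv_mul]

/-- exponential integrability for small (L²-)BMO functions -/
lemma john_nirenberg {n : ℕ} {ψ : (Fin n → ℝ) → ℝ}
    (h1 : ∀ a r, 0 < r → IntegrableOn ψ (hc a r))
    (h2 : ∀ a r, 0 < r → IntegrableOn (fun x => ψ x ^ 2) (hc a r))
    (hv : ∀ a r, 0 < r → 2 ^ n * (hmean (fun x => ψ x ^ 2) a r - hmean ψ a r ^ 2) ≤ 1 / 16)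
    (a : Fin n → ℝ) (r : ℝ) (hr : 0 < r) :
    ∫⁻ x in hc a r, ENNReal.ofReal (Real.exp (ψ x)) ≤
      ENNReal.ofReal (2 * r ^ n * Real.exp (hmean ψ a r)) := by
  have hloc : LocallyIntegrable ψ volume := by
    intro x
    refine ⟨Set.Icc (fun i => x i - 1) (fun i => (x i - 1) + 2), ?_, ?_⟩
    · rw [cube_eq_ball _ (by norm_num)]
      have : (fun i => x i - 1 + 2 / 2) = x := by ext i; norm_num
      rw [this]
      exact Metric.closedBall_mem_nhds _ (by norm_num)
    · exact (h1 (fun i => x i - 1) 2 (by norm_num)).congr_set_ae (hc_ae_eq _ _).symm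
  have hd := IsUnifLocDoublingMeasure.ae_tendsto_average volume hloc 1
  have hlim : ∀ᵐ x ∂(volume.restrict (hc a r)), ENNReal.ofReal (Real.exp (ψ x)) =
      Filter.liminf (fun k => TT ψ k a r x) atTop := by
    rw [ae_restrict_iff' (measurableSet_hc a r)]
    filter_upwards [hd] with x hx hxa
    choose A hA1 hA2 using fun k => TT_spec ψ k a r x hr hxa
    have hk : ∀ k : ℕ, 0 < r / 2 ^ k := fun k => by positivity
    have ht : Tendsto (fun k : ℕ => r / 2 ^ k / 2) atTop (nhdsWithin 0 (Set.Ioi 0)) := by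
      refine tendsto_nhdsWithin_iff.2 ⟨?_, Eventually.of_forall fun k => half_pos (hk k)⟩
      have := (tendsto_pow_atTop_nhds_zero_of_lt_one (r := (1 / 2 : ℝ)) (by norm_num)
        (by norm_num)).const_mul (r / 2)
      rw [mul_zero] at this
      refine this.congr fun k => ?_
      rw [one_div, inv_pow]; field_simp
    have h3 := hx (fun k i => A k i + r / 2 ^ k / 2) (fun k => r / 2 ^ k / 2) ht
      (Eventually.of_forall fun k => by
        rw [one_mul, ← cube_eq_ball _ (hk k), ← Set.pi_univ_Icc]
        exact Set.pi_mono (fun i _ => Set.Ico_subset_Icc_self) (hA1 k))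
    have h4 : Tendsto (fun k => TT ψ k a r x) atTop (nhds (ENNReal.ofReal (Real.exp (ψ x)))) := by
      have := (ENNReal.continuous_ofReal.comp Real.continuous_exp).continuousAt.tendsto.comp h3
      refine this.congr fun k => ?_
      simp only [Function.comp_apply, hA2, hmean_eq_average ψ (A k) (hk k)]
    exact h4.liminf_eq.symm
  rw [lintegral_congr_ae hlim]
  refine (lintegral_liminf_le fun k => measurable_TT ψ k a r).trans ?_
  refine Filter.liminf_le_of_le (by isBoundedDefault) fun b hb => ?_
  obtain ⟨k, hk⟩ := hb.exists
  refine hk.trans ((TT_bound h1 h2 hv k a r hr).trans (ENNReal.ofReal_le_ofReal ?_))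
  have h3 := hmean_sq_le hr (h1 a r hr) (h2 a r hr)
  have h4 := hv a r hr
  have h5 : (1 : ℝ) ≤ 2 ^ n := one_le_pow₀ (by norm_num)
  have hrn : 0 < r ^ n := pow_pos hr n
  have h6 : 1 + 4 * (hmean (fun x => ψ x ^ 2) a r - hmean ψ a r ^ 2)
      - 16 * (hmean (fun x => ψ x ^ 2) a r - hmean ψ a r ^ 2) ^ 2 ≤ 2 := by nlinarith
  have := mul_le_mul_of_nonneg_left h6 (mul_pos hrn (Real.exp_pos (hmean ψ a r))).le
  rw [gV]
  linarith

lemma taylor_pt {β : ℝ} (hβ : 0 < β) (t : ℝ) :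
    min 1 (β ^ 2) / 2 * t ^ 2 ≤
      (Real.exp t - 1 - t) + (Real.exp (-(β * t)) - 1 + β * t) := by
  have h1 := Real.add_one_le_exp t
  have h2 := Real.add_one_le_exp (-(β * t))
  have m1 : min 1 (β ^ 2) ≤ 1 := min_le_left _ _
  have m2 : min 1 (β ^ 2) ≤ β ^ 2 := min_le_right _ _
  rcases le_total 0 t with ht | ht
  · have := Real.quadratic_le_exp_of_nonneg ht
    nlinarith [mul_le_mul_of_nonneg_right m1 (sq_nonneg t)]
  · have := Real.quadratic_le_exp_of_nonneg (x := -(β * t)) (by nlinarith)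
    nlinarith [mul_le_mul_of_nonneg_right m2 (sq_nonneg t)]

lemma integrable_of_exp {X : Type*} [MeasurableSpace X] {ν : Measure X} [IsFiniteMeasure ν]
    {φ : X → ℝ} (hφ : Measurable φ) {β : ℝ} (hβ : 0 < β)
    (h1 : Integrable (fun x => Real.exp (φ x)) ν)
    (h2 : Integrable (fun x => Real.exp (-(β * φ x))) ν) :
    Integrable φ ν ∧ Integrable (fun x => φ x ^ 2) ν := by
  have hsq : Integrable (fun x => φ x ^ 2) ν := by
    set κ := min 1 (β ^ 2) / 2 with hκ
    have hκ0 : 0 < κ := by positivity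
    set K : ℝ := (1 - β) ^ 2 / (2 * κ)
    refine Integrable.mono' (g := fun x => (2 / κ) * (Real.exp (φ x) + Real.exp (-(β * φ x))
      + (1 - β) ^ 2 / (2 * κ))) (((h1.add h2).add (integrable_const K)).const_mul _)
      (hφ.pow_const 2).aestronglyMeasurable (Eventually.of_forall fun x => ?_)
    have h := taylor_pt hβ (φ x)
    rw [← hκ] at h
    rw [Real.norm_of_nonneg (sq_nonneg _), div_mul_eq_mul_div, le_div_iff₀ hκ0]
    have h3 : -(1 - β) * φ x ≤ κ / 2 * φ x ^ 2 + (1 - β) ^ 2 / (2 * κ) := by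
      have : 0 ≤ (κ * φ x + (1 - β)) ^ 2 / (2 * κ) := by positivity
      have e : (κ * φ x + (1 - β)) ^ 2 / (2 * κ) =
        κ / 2 * φ x ^ 2 + (1 - β) ^ 2 / (2 * κ) + (1 - β) * φ x := by field_simp; ring
      linarith
    nlinarith
  refine ⟨?_, hsq⟩
  refine Integrable.mono' (g := fun x => 1 + φ x ^ 2) ((integrable_const 1).add hsq)
    hφ.aestronglyMeasurable (Eventually.of_forall fun x => ?_)
  rw [Real.norm_eq_abs, abs_le]
  constructor <;> nlinarith [sq_nonneg (φ x - 1), sq_nonneg (φ x + 1)]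

def C1 (β : ℝ) : ℝ := 2 * (1 + β * Real.exp β) / min 1 (β ^ 2)

lemma C1_pos {β : ℝ} (hβ : 0 < β) : 0 < C1 β := by unfold C1; positivity

lemma var_bound {X : Type*} [MeasurableSpace X] {ν : Measure X} [IsProbabilityMeasure ν]
    {φ : X → ℝ} (hφ : Measurable φ) {p : ℝ} (hp : 1 < p) {ε : ℝ} (hε0 : 0 ≤ ε) (hε1 : ε ≤ 1)
    (h1 : Integrable (fun x => Real.exp (φ x)) ν)
    (h2 : Integrable (fun x => Real.exp (-(1 / (p - 1) * φ x))) ν)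
    (h : (∫ x, Real.exp (φ x) ∂ν) * (∫ x, Real.exp (-(1 / (p - 1) * φ x)) ∂ν) ^ (p - 1) ≤ 1 + ε) :
    ∫ x, φ x ^ 2 ∂ν - (∫ x, φ x ∂ν) ^ 2 ≤ C1 (1 / (p - 1)) * ε := by
  have hp1 : 0 < p - 1 := by linarith
  set β := 1 / (p - 1) with hβd
  have hβ : 0 < β := by positivity
  obtain ⟨i1, i2⟩ := integrable_of_exp hφ hβ h1 h2
  set c := ∫ x, φ x ∂ν with hc
  have e1 : ∀ x, Real.exp (φ x - c) = Real.exp (-c) * Real.exp (φ x) := fun x => by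
    rw [← Real.exp_add]; ring_nf
  have e2 : ∀ x, Real.exp (-(β * (φ x - c))) = Real.exp (β * c) * Real.exp (-(β * φ x)) :=
    fun x => by rw [← Real.exp_add]; ring_nf
  have j1 : Integrable (fun x => Real.exp (φ x - c)) ν := by
    simp only [e1]; exact h1.const_mul _
  have j2 : Integrable (fun x => Real.exp (-(β * (φ x - c)))) ν := by
    simp only [e2]; exact h2.const_mul _
  have jt : Integrable (fun x => φ x - c) ν := i1.sub (integrable_const c)
  have hA : ∫ x, (Real.exp (φ x - c) - 1 - (φ x - c)) ∂ν = ∫ x, Real.exp (φ x - c) ∂ν - 1 := by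
    rw [integral_sub (by exact j1.sub (integrable_const 1)) jt,
      integral_sub j1 (integrable_const 1), integral_sub i1 (integrable_const c)]
    simp [← hc]
  have hB : ∫ x, (Real.exp (-(β * (φ x - c))) - 1 + β * (φ x - c)) ∂ν =
      ∫ x, Real.exp (-(β * (φ x - c))) ∂ν - 1 := by
    rw [integral_add (by exact j2.sub (integrable_const 1)) (jt.const_mul _),
      integral_sub j2 (integrable_const 1), integral_const_mul, integral_sub i1 (integrable_const c)]
    simp [← hc]
  set x := ∫ x, Real.exp (φ x - c) ∂ν with hx
  set y := ∫ x, Real.exp (-(β * (φ x - c))) ∂ν with hy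
  have hx1 : 1 ≤ x := by
    have : 0 ≤ ∫ x, (Real.exp (φ x - c) - 1 - (φ x - c)) ∂ν :=
      integral_nonneg fun z => by
        have := Real.add_one_le_exp (φ z - c)
        simp only [Pi.zero_apply]; linarith
    linarith
  have hy1 : 1 ≤ y := by
    have : 0 ≤ ∫ x, (Real.exp (-(β * (φ x - c))) - 1 + β * (φ x - c)) ∂ν :=
      integral_nonneg fun z => by
        have := Real.add_one_le_exp (-(β * (φ z - c)))
        simp only [Pi.zero_apply]; linarith
    linarith
  have hV : ∫ x, (φ x - c) ^ 2 ∂ν = ∫ x, φ x ^ 2 ∂ν - c ^ 2 := by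
    have : (fun x => (φ x - c) ^ 2) = fun x => φ x ^ 2 - 2 * c * φ x + c ^ 2 := by
      ext x; ring
    rw [this, integral_add (by exact i2.sub (i1.const_mul _)) (integrable_const _),
      integral_sub i2 (i1.const_mul _), integral_const_mul]
    simp [← hc]; ring
  have iV : Integrable (fun x => (φ x - c) ^ 2) ν := by
    have : (fun x => (φ x - c) ^ 2) = fun x => φ x ^ 2 - 2 * c * φ x + c ^ 2 := by
      ext x; ring
    rw [this]
    exact (i2.sub (i1.const_mul _)).add (integrable_const _)
  have hmain : min 1 (β ^ 2) / 2 * (∫ x, φ x ^ 2 ∂ν - c ^ 2) ≤ (x - 1) + (y - 1) := by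
    have iA : Integrable (fun x => Real.exp (φ x - c) - 1 - (φ x - c)) ν :=
      (j1.sub (integrable_const 1)).sub jt
    have iB : Integrable (fun x => Real.exp (-(β * (φ x - c))) - 1 + β * (φ x - c)) ν :=
      (j2.sub (integrable_const 1)).add (jt.const_mul _)
    rw [← hV, ← hA, ← hB, ← integral_const_mul, ← integral_add iA iB]
    exact integral_mono (iV.const_mul _) (iA.add iB) fun z => taylor_pt hβ (φ z - c)
  have hprod : x * y ^ (p - 1) ≤ 1 + ε := by
    refine le_trans (le_of_eq ?_) h
    rw [hx, hy]
    simp only [e1, e2]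
    rw [integral_const_mul, integral_const_mul, Real.mul_rpow (Real.exp_pos _).le
      (integral_nonneg fun z => (Real.exp_pos _).le), ← Real.exp_mul]
    have : β * c * (p - 1) = c := by rw [hβd]; field_simp
    rw [this]
    have : Real.exp (-c) * Real.exp c = 1 := by rw [← Real.exp_add]; simp
    linear_combination (∫ x, Real.exp (φ x) ∂ν) * (∫ x, Real.exp (-(β * φ x)) ∂ν) ^ (p - 1) * this
  have hyp : 1 ≤ y ^ (p - 1) := Real.one_le_rpow hy1 hp1.le
  have hxe : x - 1 ≤ ε := by nlinarith
  have hye : y ^ (p - 1) ≤ 1 + ε := by nlinarith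
  have hye2 : y ≤ Real.exp (β * ε) := by
    have : y = (y ^ (p - 1)) ^ β := by
      rw [← Real.rpow_mul (by linarith), hβd, mul_one_div_cancel hp1.ne', Real.rpow_one]
    rw [this]
    calc (y ^ (p - 1)) ^ β ≤ (Real.exp ε) ^ β := by
          refine Real.rpow_le_rpow (by linarith) ?_ hβ.le
          linarith [Real.add_one_le_exp ε]
      _ = _ := by rw [← Real.exp_mul, mul_comm]
  have hye3 : y - 1 ≤ β * Real.exp β * ε := by
    have h3 := Real.add_one_le_exp (-(β * ε))
    have h4 : Real.exp (β * ε) * Real.exp (-(β * ε)) = 1 := by rw [← Real.exp_add]; simp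
    have h5 : Real.exp (β * ε) ≤ Real.exp β := Real.exp_le_exp.2 (by nlinarith)
    have h6 := mul_le_mul_of_nonneg_left h3 (Real.exp_pos (β * ε)).le
    have h7 := mul_le_mul_of_nonneg_left h5 (mul_nonneg hβ.le hε0)
    nlinarith
  have hmin : 0 < min 1 (β ^ 2) := by positivity
  rw [C1, div_mul_eq_mul_div, le_div_iff₀ hmin]
  nlinarith

/-- normalised measure on a cube -/
def nuQ {n : ℕ} (a : Fin n → ℝ) (r : ℝ) : Measure (Fin n → ℝ) :=
  (ENNReal.ofReal (r ^ n))⁻¹ • volume.restrict (hc a r)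

lemma nuQ_prob {n : ℕ} (a : Fin n → ℝ) {r : ℝ} (hr : 0 < r) : IsProbabilityMeasure (nuQ a r) := by
  constructor
  have hrn : 0 < r ^ n := pow_pos hr n
  simp only [nuQ, Measure.smul_apply, Measure.restrict_apply_univ, volume_hc a hr, smul_eq_mul]
  exact ENNReal.inv_mul_cancel (by simpa using hrn) ENNReal.ofReal_ne_top

lemma hmean_eq_nuQ {n : ℕ} (ψ : (Fin n → ℝ) → ℝ) (a : Fin n → ℝ) {r : ℝ} (hr : 0 < r) :
    hmean ψ a r = ∫ x, ψ x ∂(nuQ a r) := by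
  have hrn : 0 < r ^ n := pow_pos hr n
  rw [nuQ, integral_smul_measure, hmean, ENNReal.toReal_inv, ENNReal.toReal_ofReal hrn.le,
    smul_eq_mul, div_eq_inv_mul]

lemma avg_eq_nuQ {n : ℕ} (f : (Fin n → ℝ) → ℝ) (a : Fin n → ℝ) {r : ℝ} (hr : 0 < r) :
    avg (Set.Icc a (fun i => a i + r)) f = ∫⁻ x, ENNReal.ofReal (f x) ∂(nuQ a r) := by
  rw [nuQ, lintegral_smul_measure, avg, volume_cube a hr, setLIntegral_congr (hc_ae_eq a r),
    smul_eq_mul, div_eq_mul_inv, mul_comm]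

lemma integrable_nuQ_iff {n : ℕ} (f : (Fin n → ℝ) → ℝ) (a : Fin n → ℝ) {r : ℝ} (hr : 0 < r) :
    Integrable f (nuQ a r) ↔ IntegrableOn f (hc a r) := by
  have hrn : 0 < r ^ n := pow_pos hr n
  rw [nuQ, integrable_smul_measure (by simp) (by simpa using hrn)]
  rfl

lemma integrable_exp_iff {X : Type*} [MeasurableSpace X] {ν : Measure X} {φ : X → ℝ}
    (hφ : Measurable φ) (h : ∫⁻ x, ENNReal.ofReal (Real.exp (φ x)) ∂ν ≠ ⊤) :
    Integrable (fun x => Real.exp (φ x)) ν := by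
  refine ⟨hφ.exp.aestronglyMeasurable, ?_⟩
  rw [hasFiniteIntegral_iff_ofReal (Eventually.of_forall fun x => (Real.exp_pos _).le)]
  exact h.lt_top

/-- the variance bound on cubes for flat weights -/
lemma var_cube {n : ℕ} {φ : (Fin n → ℝ) → ℝ} (hφ : Measurable φ) {p : ℝ} (hp : 1 < p) {ε : ℝ}
    (hε0 : 0 ≤ ε) (hε1 : ε ≤ 1)
    (hloc : ∀ a r, 0 < r → IntegrableOn (fun x => Real.exp (φ x)) (hc a r))
    (h : ∀ Q, IsCube Q → avg Q (fun x => Real.exp (φ x)) *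
      (avg Q (fun x => Real.exp (-(1 / (p - 1) * φ x)))) ^ (p - 1) ≤ ENNReal.ofReal (1 + ε))
    (a : Fin n → ℝ) (r : ℝ) (hr : 0 < r) :
    IntegrableOn φ (hc a r) ∧ IntegrableOn (fun x => φ x ^ 2) (hc a r) ∧
      hmean (fun x => φ x ^ 2) a r - hmean φ a r ^ 2 ≤ C1 (1 / (p - 1)) * ε := by
  have hp1 : 0 < p - 1 := by linarith
  have := nuQ_prob a hr
  have h1 : Integrable (fun x => Real.exp (φ x)) (nuQ a r) :=
    (integrable_nuQ_iff _ a hr).2 (hloc a r hr)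
  have hh := h _ ⟨a, r, hr, rfl⟩
  rw [avg_eq_nuQ _ a hr, avg_eq_nuQ _ a hr] at hh
  have hpos : ∫⁻ x, ENNReal.ofReal (Real.exp (φ x)) ∂(nuQ a r) ≠ 0 := by
    intro h0
    rw [lintegral_eq_zero_iff hφ.exp.ennreal_ofReal] at h0
    obtain ⟨x, hx⟩ := h0.exists
    have := Real.exp_pos (φ x)
    simp only [Pi.zero_apply, ENNReal.ofReal_eq_zero] at hx
    linarith
  have h2 : Integrable (fun x => Real.exp (-(1 / (p - 1) * φ x))) (nuQ a r) := by
    refine integrable_exp_iff (hφ.const_mul _).neg fun ht => ?_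
    rw [ht, ENNReal.top_rpow_of_pos hp1, ENNReal.mul_top hpos] at hh
    exact absurd (top_le_iff.1 hh) ENNReal.ofReal_ne_top
  obtain ⟨i1, i2⟩ := integrable_of_exp hφ (by positivity) h1 h2
  refine ⟨(integrable_nuQ_iff _ a hr).1 i1, (integrable_nuQ_iff _ a hr).1 i2, ?_⟩
  rw [hmean_eq_nuQ _ a hr, hmean_eq_nuQ _ a hr]
  refine var_bound hφ hp hε0 hε1 h1 h2 ?_
  rw [← ofReal_integral_eq_lintegral_ofReal h1 (Eventually.of_forall fun x => (Real.exp_pos _).le),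
    ← ofReal_integral_eq_lintegral_ofReal h2 (Eventually.of_forall fun x => (Real.exp_pos _).le),
    ENNReal.ofReal_rpow_of_nonneg (integral_nonneg fun x => (Real.exp_pos _).le) hp1.le,
    ← ENNReal.ofReal_mul (integral_nonneg fun x => (Real.exp_pos _).le),
    ENNReal.ofReal_le_ofReal_iff (by linarith)] at hh
  exact hh

/-- condition `A_q` in the form we use -/
def AqCond {n : ℕ} (q : ℝ) (Φ : (Fin n → ℝ) → ℝ) : Prop :=
  ∀ a r, 0 < r → (∫⁻ x in Set.Icc a (fun i => a i + r), ENNReal.ofReal (Real.exp (Φ x))) *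
    (∫⁻ x in Set.Icc a (fun i => a i + r), ENNReal.ofReal (Real.exp (-(1 / (q - 1) * Φ x)))) ^ (q - 1)
      ≤ ENNReal.ofReal (2 ^ q) * volume (Set.Icc a (fun i => a i + r)) ^ q

lemma jn_scaled {n : ℕ} {φ : (Fin n → ℝ) → ℝ} {V : ℝ}
    (h : ∀ a r, 0 < r → IntegrableOn φ (hc a r) ∧ IntegrableOn (fun x => φ x ^ 2) (hc a r) ∧
      hmean (fun x => φ x ^ 2) a r - hmean φ a r ^ 2 ≤ V) (s : ℝ) (hs : 2 ^ n * (s ^ 2 * V) ≤ 1 / 16)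
    (a : Fin n → ℝ) (r : ℝ) (hr : 0 < r) :
    ∫⁻ x in Set.Icc a (fun i => a i + r), ENNReal.ofReal (Real.exp (s * φ x)) ≤
      ENNReal.ofReal (2 * r ^ n * Real.exp (s * hmean φ a r)) := by
  have e1 : ∀ a r, hmean (fun x => s * φ x) a r = s * hmean φ a r := by
    intro a r; unfold hmean; rw [integral_const_mul, mul_div_assoc]
  have e2 : ∀ a r, hmean (fun x => (s * φ x) ^ 2) a r = s ^ 2 * hmean (fun x => φ x ^ 2) a r := by
    intro a r; unfold hmean; simp only [mul_pow]; rw [integral_const_mul, mul_div_assoc]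
  rw [← setLIntegral_congr (hc_ae_eq a r), ← e1]
  refine john_nirenberg (ψ := fun x => s * φ x) (fun a r hr => (h a r hr).1.const_mul _)
    (fun a r hr => ?_) (fun a r hr => ?_) a r hr
  · simp only [mul_pow]; exact (h a r hr).2.1.const_mul _
  · rw [e1, e2]
    have := mul_le_mul_of_nonneg_left (h a r hr).2.2 (sq_nonneg s)
    have h2 : (0 : ℝ) < 2 ^ n := by positivity
    have := mul_le_mul_of_nonneg_left this h2.le
    nlinarith

lemma aqCond_of_var {n : ℕ} {φ : (Fin n → ℝ) → ℝ} {V : ℝ}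
    (h : ∀ a r, 0 < r → IntegrableOn φ (hc a r) ∧ IntegrableOn (fun x => φ x ^ 2) (hc a r) ∧
      hmean (fun x => φ x ^ 2) a r - hmean φ a r ^ 2 ≤ V) {q : ℝ} (hq : 1 < q) (s : ℝ)
    (hs : 2 ^ n * (s ^ 2 * V) ≤ 1 / 16) (hs' : 2 ^ n * ((s / (q - 1)) ^ 2 * V) ≤ 1 / 16) :
    AqCond q (fun x => s * φ x) := by
  intro a r hr
  have hq1 : 0 < q - 1 := by linarith
  have hrn : 0 < r ^ n := pow_pos hr n
  have k1 := jn_scaled h s hs a r hr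
  have k2 := jn_scaled h (-(s / (q - 1))) (by rwa [neg_sq]) a r hr
  have e : ∀ x, -(1 / (q - 1) * (s * φ x)) = -(s / (q - 1)) * φ x := fun x => by field_simp
  simp only [e]
  refine (mul_le_mul' k1 (ENNReal.rpow_le_rpow k2 hq1.le)).trans (le_of_eq ?_)
  rw [volume_cube a hr, ENNReal.ofReal_rpow_of_pos hrn, ENNReal.ofReal_rpow_of_pos (by positivity),
    ← ENNReal.ofReal_mul (by positivity), ← ENNReal.ofReal_mul (by positivity)]
  congr 1
  rw [Real.mul_rpow (by positivity) (Real.exp_pos _).le, ← Real.exp_mul]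
  have : -(s / (q - 1)) * hmean φ a r * (q - 1) = -(s * hmean φ a r) := by field_simp
  rw [this]
  have e3 : Real.exp (s * hmean φ a r) * Real.exp (-(s * hmean φ a r)) = 1 := by
    rw [← Real.exp_add]; simp
  have e4 : (2 * r ^ n) * (2 * r ^ n) ^ (q - 1) = (2 * r ^ n) ^ q := by
    rw [← Real.rpow_one_add' (by positivity) (by linarith)]; ring_nf
  rw [← Real.mul_rpow (by norm_num) hrn.le, ← e4]
  linear_combination ((2 * r ^ n) * (2 * r ^ n) ^ (q - 1)) * e3

/-- the measure `e^Φ dx` -/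
def wmu {n : ℕ} (Φ : (Fin n → ℝ) → ℝ) : Measure (Fin n → ℝ) :=
  volume.withDensity (fun x => ENNReal.ofReal (Real.exp (Φ x)))

lemma ball_eq_cube {n : ℕ} (c : Fin n → ℝ) {ρ : ℝ} (hρ : 0 < ρ) :
    Metric.closedBall c ρ = Set.Icc (fun i => c i - ρ) (fun i => (c i - ρ) + 2 * ρ) := by
  have := cube_eq_ball (fun i => c i - ρ) (r := 2 * ρ) (by linarith)
  rw [this]
  congr 1
  · ext i; ring
  · ring

lemma volume_ball {n : ℕ} (c : Fin n → ℝ) {ρ : ℝ} (hρ : 0 < ρ) :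
    volume (Metric.closedBall c ρ) = ENNReal.ofReal ((2 * ρ) ^ n) := by
  rw [ball_eq_cube c hρ, volume_cube _ (by linarith)]

lemma isCube_iff {n : ℕ} (Q : Set (Fin n → ℝ)) :
    IsCube Q ↔ ∃ c ρ, 0 < ρ ∧ Q = Metric.closedBall c ρ := by
  constructor
  · rintro ⟨a, r, hr, rfl⟩
    exact ⟨_, r / 2, by linarith, cube_eq_ball a hr⟩
  · rintro ⟨c, ρ, hρ, rfl⟩
    exact ⟨_, 2 * ρ, by linarith, ball_eq_cube c hρ⟩

lemma holder_cube {n : ℕ} {Φ : (Fin n → ℝ) → ℝ} (hΦ : Measurable Φ) {q : ℝ} (hq : 1 < q)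
    (hA : AqCond q Φ) {F : (Fin n → ℝ) → ℝ≥0∞} (hF : Measurable F) (c : Fin n → ℝ) {ρ : ℝ}
    (hρ : 0 < ρ) :
    (∫⁻ x in Metric.closedBall c ρ, F x) ^ q * wmu Φ (Metric.closedBall c ρ) ≤
      ENNReal.ofReal (2 ^ q) * volume (Metric.closedBall c ρ) ^ q *
        ∫⁻ x in Metric.closedBall c ρ, F x ^ q ∂(wmu Φ) := by
  have hq0 : 0 < q := by linarith
  have hq1 : 0 < q - 1 := by linarith
  have hB : MeasurableSet (Metric.closedBall c ρ) := Metric.isClosed_closedBall.measurableSet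
  have hU : Measurable fun x => ENNReal.ofReal (Real.exp (Φ x)) := hΦ.exp.ennreal_ofReal
  have hA' := hA (fun i => c i - ρ) (2 * ρ) (by linarith)
  rw [← ball_eq_cube c hρ] at hA'
  set B := Metric.closedBall c ρ with hBd
  have e1 : ∫⁻ x in B, F x ^ q ∂(wmu Φ) =
      ∫⁻ x in B, F x ^ q * ENNReal.ofReal (Real.exp (Φ x)) := by
    rw [wmu, setLIntegral_withDensity_eq_setLIntegral_mul _ hU (hF.pow_const q) hB]
    simp [mul_comm]
  have e2 : wmu Φ B = ∫⁻ x in B, ENNReal.ofReal (Real.exp (Φ x)) := withDensity_apply _ hB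
  have hol := ENNReal.lintegral_mul_norm_pow_le (μ := volume.restrict B)
    (f := fun x => F x ^ q * ENNReal.ofReal (Real.exp (Φ x)))
    (g := fun x => ENNReal.ofReal (Real.exp (-(1 / (q - 1) * Φ x))))
    ((hF.pow_const q).mul hU).aemeasurable
    ((hΦ.const_mul _).neg.exp.ennreal_ofReal).aemeasurable (p := 1 / q) (q := (q - 1) / q)
    (by positivity) (by positivity) (by field_simp; ring)
  have e3 : ∀ x, (F x ^ q * ENNReal.ofReal (Real.exp (Φ x))) ^ (1 / q) *
      ENNReal.ofReal (Real.exp (-(1 / (q - 1) * Φ x))) ^ ((q - 1) / q) = F x := by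
    intro x
    rw [ENNReal.mul_rpow_of_nonneg _ _ (by positivity), ← ENNReal.rpow_mul,
      mul_one_div_cancel hq0.ne', ENNReal.rpow_one, ENNReal.ofReal_rpow_of_pos (Real.exp_pos _),
      ENNReal.ofReal_rpow_of_pos (Real.exp_pos _), mul_assoc,
      ← ENNReal.ofReal_mul (by positivity), ← Real.exp_mul, ← Real.exp_mul, ← Real.exp_add]
    have : Φ x * (1 / q) + -(1 / (q - 1) * Φ x) * ((q - 1) / q) = 0 := by field_simp; ring
    rw [this]; simp
  simp only [e3] at hol
  have hol2 := ENNReal.rpow_le_rpow hol hq0.le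
  rw [ENNReal.mul_rpow_of_nonneg _ _ hq0.le, ← ENNReal.rpow_mul, ← ENNReal.rpow_mul,
    one_div_mul_cancel hq0.ne', ENNReal.rpow_one, div_mul_cancel₀ _ hq0.ne'] at hol2
  rw [e1, e2]
  calc _ ≤ _ := mul_le_mul_left hol2 _
    _ = (∫⁻ x in B, F x ^ q * ENNReal.ofReal (Real.exp (Φ x))) *
      ((∫⁻ x in B, ENNReal.ofReal (Real.exp (Φ x))) *
       (∫⁻ x in B, ENNReal.ofReal (Real.exp (-(1 / (q - 1) * Φ x)))) ^ (q - 1)) := by ring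
    _ ≤ _ := mul_le_mul_right hA' _
    _ = _ := by ring

lemma doubling {n : ℕ} {Φ : (Fin n → ℝ) → ℝ} (hΦ : Measurable Φ) {q : ℝ} (hq : 1 < q)
    (hA : AqCond q Φ) (c : Fin n → ℝ) {ρ : ℝ} (hρ : 0 < ρ) :
    wmu Φ (Metric.closedBall c (5 * ρ)) ≤
      ENNReal.ofReal (2 ^ q * (5 ^ n) ^ q) * wmu Φ (Metric.closedBall c ρ) := by
  have hq0 : 0 < q := by linarith
  have hB : MeasurableSet (Metric.closedBall c ρ) := Metric.isClosed_closedBall.measurableSet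
  have hsub : Metric.closedBall c ρ ⊆ Metric.closedBall c (5 * ρ) :=
    Metric.closedBall_subset_closedBall (by linarith)
  have h := holder_cube hΦ hq hA (F := (Metric.closedBall c ρ).indicator 1)
    (measurable_one.indicator hB) c (ρ := 5 * ρ) (by linarith)
  have e1 : ∀ ν : Measure (Fin n → ℝ), ∫⁻ x in Metric.closedBall c (5 * ρ),
      (Metric.closedBall c ρ).indicator 1 x ∂ν = ν (Metric.closedBall c ρ) := by
    intro ν
    rw [lintegral_indicator_one hB, Measure.restrict_apply hB, Set.inter_eq_left.2 hsub]
  have e2 : ∀ x, (Metric.closedBall c ρ).indicator (1 : (Fin n → ℝ) → ℝ≥0∞) x ^ q =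
      (Metric.closedBall c ρ).indicator 1 x := by
    intro x
    by_cases hx : x ∈ Metric.closedBall c ρ
    · rw [Set.indicator_of_mem hx]; simp
    · rw [Set.indicator_of_notMem hx, ENNReal.zero_rpow_of_pos hq0]
  simp only [e2, e1] at h
  have hv : volume (Metric.closedBall c (5 * ρ)) =
      ENNReal.ofReal (5 ^ n) * volume (Metric.closedBall c ρ) := by
    rw [volume_ball c hρ, volume_ball c (by linarith), ← ENNReal.ofReal_mul (by positivity),
      ← mul_pow]
    congr 2; ring
  rw [hv, ENNReal.mul_rpow_of_nonneg _ _ hq0.le, volume_ball c hρ] at h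
  set v := ENNReal.ofReal ((2 * ρ) ^ n) ^ q with hvd
  have hv0 : v ≠ 0 := by
    rw [hvd, ENNReal.ofReal_rpow_of_pos (by positivity)]
    simp only [ne_eq, ENNReal.ofReal_eq_zero, not_le]; positivity
  have hvt : v ≠ ⊤ := by
    rw [hvd, ENNReal.ofReal_rpow_of_pos (by positivity)]; exact ENNReal.ofReal_ne_top
  rw [← ENNReal.mul_le_mul_iff_right hv0 hvt]
  refine h.trans (le_of_eq ?_)
  rw [ENNReal.ofReal_mul (by positivity), ENNReal.ofReal_rpow_of_pos (by positivity)]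
  ring

def KK (n : ℕ) (q : ℝ) : ℝ := 2 ^ q * (5 ^ n) ^ q * 2 ^ q

lemma weak_aux {n : ℕ} {Φ : (Fin n → ℝ) → ℝ} (hΦ : Measurable Φ) {q : ℝ} (hq : 1 < q)
    (hA : AqCond q Φ) {F : (Fin n → ℝ) → ℝ≥0∞} (hF : Measurable F) (lam : ℝ≥0∞) (R : ℝ) :
    lam ^ q * wmu Φ {x | ∃ b : (Fin n → ℝ) × ℝ, (0 < b.2 ∧ b.2 ≤ R ∧
      lam * volume (Metric.closedBall b.1 b.2) < ∫⁻ y in Metric.closedBall b.1 b.2, F y) ∧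
        x ∈ Metric.closedBall b.1 b.2} ≤ ENNReal.ofReal (KK n q) * ∫⁻ y, F y ^ q ∂(wmu Φ) := by
  have hq0 : 0 < q := by linarith
  set t : Set ((Fin n → ℝ) × ℝ) := {b | 0 < b.2 ∧ b.2 ≤ R ∧
      lam * volume (Metric.closedBall b.1 b.2) < ∫⁻ y in Metric.closedBall b.1 b.2, F y} with ht
  obtain ⟨u, hut, hdisj, hcov⟩ := Vitali.exists_disjoint_subfamily_covering_enlargement_closedBall
    t (fun b => b.1) (fun b => b.2) R (fun a ha => ha.2.1) 5 (by norm_num)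
  have hcount : u.Countable := hdisj.countable_of_nonempty_interior fun b hb => by
    refine ⟨b.1, ?_⟩
    exact Metric.ball_subset_interior_closedBall (Metric.mem_ball_self (hut hb).1)
  have hlam : ∀ b ∈ u, lam ^ q * wmu Φ (Metric.closedBall b.1 b.2) ≤
      ENNReal.ofReal (2 ^ q) * ∫⁻ x in Metric.closedBall b.1 b.2, F x ^ q ∂(wmu Φ) := by
    intro b hb
    obtain ⟨h1, h2, h3⟩ := hut hb
    have h := holder_cube hΦ hq hA hF b.1 h1
    have h4 := ENNReal.rpow_le_rpow h3.le hq0.le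
    rw [ENNReal.mul_rpow_of_nonneg _ _ hq0.le] at h4
    have h5 := (mul_le_mul_left h4 _).trans h
    rw [volume_ball b.1 h1] at h5
    set v := ENNReal.ofReal ((2 * b.2) ^ n) ^ q with hvd
    have hv0 : v ≠ 0 := by
      rw [hvd, ENNReal.ofReal_rpow_of_pos (by positivity)]
      simp only [ne_eq, ENNReal.ofReal_eq_zero, not_le]; positivity
    have hvt : v ≠ ⊤ := by
      rw [hvd, ENNReal.ofReal_rpow_of_pos (by positivity)]; exact ENNReal.ofReal_ne_top
    rw [← ENNReal.mul_le_mul_iff_right hv0 hvt]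
    calc _ = _ := by ring
      _ ≤ _ := h5
      _ = _ := by ring
  have hsub : {x | ∃ b : (Fin n → ℝ) × ℝ, (0 < b.2 ∧ b.2 ≤ R ∧
      lam * volume (Metric.closedBall b.1 b.2) < ∫⁻ y in Metric.closedBall b.1 b.2, F y) ∧
        x ∈ Metric.closedBall b.1 b.2} ⊆ ⋃ b ∈ u, Metric.closedBall b.1 (5 * b.2) := by
    rintro x ⟨b, hb, hx⟩
    obtain ⟨b', hb', hs⟩ := hcov b hb
    exact Set.mem_biUnion hb' (hs hx)
  have := hcount.to_subtype
  have hsum : ∑' b : u, lam ^ q * wmu Φ (Metric.closedBall b.1.1 b.1.2) ≤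
      ∑' b : u, ENNReal.ofReal (2 ^ q) *
          ∫⁻ x in Metric.closedBall b.1.1 b.1.2, F x ^ q ∂(wmu Φ) := by
    apply ENNReal.tsum_le_tsum
    intro b
    exact hlam b.1 b.2
  calc _ ≤ lam ^ q * wmu Φ (⋃ b ∈ u, Metric.closedBall b.1 (5 * b.2)) := by gcongr
    _ ≤ lam ^ q * ∑' b : u, wmu Φ (Metric.closedBall b.1.1 (5 * b.1.2)) := by
        gcongr
        exact measure_biUnion_le _ hcount _
    _ ≤ lam ^ q * ∑' b : u, ENNReal.ofReal (2 ^ q * (5 ^ n) ^ q) *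
          wmu Φ (Metric.closedBall b.1.1 b.1.2) := by
        gcongr with b
        exact doubling hΦ hq hA _ (hut b.2).1
    _ = ENNReal.ofReal (2 ^ q * (5 ^ n) ^ q) * ∑' b : u, lam ^ q *
          wmu Φ (Metric.closedBall b.1.1 b.1.2) := by
        rw [ENNReal.tsum_mul_left, ENNReal.tsum_mul_left]; ring
    _ ≤ ENNReal.ofReal (2 ^ q * (5 ^ n) ^ q) * ∑' b : u, ENNReal.ofReal (2 ^ q) *
          ∫⁻ x in Metric.closedBall b.1.1 b.1.2, F x ^ q ∂(wmu Φ) := by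
        exact mul_le_mul_right hsum _
    _ = ENNReal.ofReal (KK n q) * ∫⁻ x in ⋃ b : u, Metric.closedBall b.1.1 b.1.2,
          F x ^ q ∂(wmu Φ) := by
        rw [ENNReal.tsum_mul_left, lintegral_iUnion
          (fun b : u => Metric.isClosed_closedBall.measurableSet), KK,
          ENNReal.ofReal_mul (p := 2 ^ q * (5 ^ n) ^ q) (by positivity), mul_assoc]
        intro b c hbc
        exact hdisj b.2 c.2 (fun h => hbc (Subtype.ext h))
    _ ≤ _ := by
        gcongr
        exact Measure.restrict_le_self

lemma lt_maximalE_iff {n : ℕ} (f : (Fin n → ℝ) → ℝ) (x : Fin n → ℝ) (lam : ℝ≥0∞) :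
    lam < maximalE f x ↔ ∃ c ρ, 0 < ρ ∧ x ∈ Metric.closedBall c ρ ∧
      lam * volume (Metric.closedBall c ρ) <
        ∫⁻ y in Metric.closedBall c ρ, ENNReal.ofReal |f y| := by
  have key : ∀ c ρ, 0 < ρ → (lam < avg (Metric.closedBall c ρ) (fun y => |f y|) ↔
      lam * volume (Metric.closedBall c ρ) <
        ∫⁻ y in Metric.closedBall c ρ, ENNReal.ofReal |f y|) := by
    intro c ρ hρ
    rw [avg, ENNReal.lt_div_iff_mul_lt]
    · left; rw [volume_ball c hρ]; simp only [ne_eq, ENNReal.ofReal_eq_zero, not_le]; positivity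
    · left; rw [volume_ball c hρ]; exact ENNReal.ofReal_ne_top
  simp only [maximalE, lt_iSup_iff]
  constructor
  · rintro ⟨Q, hQ, hx, h⟩
    obtain ⟨c, ρ, hρ, rfl⟩ := (isCube_iff Q).1 hQ
    exact ⟨c, ρ, hρ, hx, (key c ρ hρ).1 h⟩
  · rintro ⟨c, ρ, hρ, hx, h⟩
    exact ⟨_, (isCube_iff _).2 ⟨c, ρ, hρ, rfl⟩, hx, (key c ρ hρ).2 h⟩

lemma weak_type {n : ℕ} {Φ : (Fin n → ℝ) → ℝ} (hΦ : Measurable Φ) {q : ℝ} (hq : 1 < q)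
    (hA : AqCond q Φ) {f : (Fin n → ℝ) → ℝ} (hf : Measurable f) (lam : ℝ≥0∞) :
    lam ^ q * wmu Φ {x | lam < maximalE f x} ≤
      ENNReal.ofReal (KK n q) * ∫⁻ y, ENNReal.ofReal |f y| ^ q ∂(wmu Φ) := by
  have hF : Measurable fun y => ENNReal.ofReal |f y| := hf.abs.ennreal_ofReal
  set S : ℕ → Set (Fin n → ℝ) := fun N => {x | ∃ b : (Fin n → ℝ) × ℝ, (0 < b.2 ∧ b.2 ≤ (N : ℝ) ∧
      lam * volume (Metric.closedBall b.1 b.2) <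
        ∫⁻ y in Metric.closedBall b.1 b.2, ENNReal.ofReal |f y|) ∧
        x ∈ Metric.closedBall b.1 b.2} with hS
  have hmono : Monotone S := by
    rintro N M hNM x ⟨b, ⟨h1, h2, h3⟩, h4⟩
    exact ⟨b, ⟨h1, h2.trans (by exact_mod_cast hNM), h3⟩, h4⟩
  have hU : {x | lam < maximalE f x} = ⋃ N, S N := by
    ext x
    simp only [Set.mem_ofPred_eq, lt_maximalE_iff, Set.mem_iUnion, hS]
    constructor
    · rintro ⟨c, ρ, h1, h2, h3⟩
      obtain ⟨N, hN⟩ := exists_nat_ge ρ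
      exact ⟨N, (c, ρ), ⟨h1, hN, h3⟩, h2⟩
    · rintro ⟨N, b, ⟨h1, _, h3⟩, h2⟩
      exact ⟨b.1, b.2, h1, h2, h3⟩
  rw [hU, hmono.measure_iUnion, ENNReal.mul_iSup]
  exact iSup_le fun N => weak_aux hΦ hq hA hF lam N

lemma measurable_maximalE {n : ℕ} (f : (Fin n → ℝ) → ℝ) : Measurable (maximalE f) := by
  refine measurable_of_Ioi fun lam => IsOpen.measurableSet ?_
  rw [isOpen_iff_mem_nhds]
  intro x hx
  have hlt : lam ≠ ⊤ := (lt_of_lt_of_le (Set.mem_Ioi.1 hx) le_top).ne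
  obtain ⟨c, ρ, hρ, hxc, h⟩ := (lt_maximalE_iff f x lam).1 hx
  rw [volume_ball c hρ] at h
  have hcont : Tendsto (fun s : ℝ => lam * ENNReal.ofReal ((2 * s) ^ n))
      (nhdsWithin ρ (Set.Ioi ρ)) (nhds (lam * ENNReal.ofReal ((2 * ρ) ^ n))) := by
    have : Continuous fun s : ℝ => lam * ENNReal.ofReal ((2 * s) ^ n) :=
      (ENNReal.continuous_const_mul hlt).comp (ENNReal.continuous_ofReal.comp (by fun_prop))
    exact this.continuousAt.tendsto.mono_left nhdsWithin_le_nhds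
  obtain ⟨s, hs1, hs2⟩ := ((hcont.eventually (gt_mem_nhds h)).and self_mem_nhdsWithin).exists
  have hs2 : ρ < s := hs2
  have hs0 : 0 < s := hρ.trans hs2
  refine mem_of_superset (Metric.isOpen_ball.mem_nhds
    (Metric.mem_ball.2 (lt_of_le_of_lt (Metric.mem_closedBall.1 hxc) hs2))) fun y hy => ?_
  refine (lt_maximalE_iff f y lam).2 ⟨c, s, hs0, Metric.ball_subset_closedBall hy, ?_⟩
  rw [volume_ball c hs0]
  exact hs1.trans_le (lintegral_mono_set (Metric.closedBall_subset_closedBall hs2.le))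

lemma maximalE_split {n : ℕ} {f : (Fin n → ℝ) → ℝ} (hf : Measurable f) {t : ℝ} (ht : 0 < t)
    (x : Fin n → ℝ) (hx : ENNReal.ofReal t < maximalE f x) :
    ENNReal.ofReal (t / 2) < maximalE ({y | t < 2 * |f y|}.indicator f) x := by
  obtain ⟨c, ρ, hρ, hxc, h⟩ := (lt_maximalE_iff f x _).1 hx
  refine (lt_maximalE_iff _ x _).2 ⟨c, ρ, hρ, hxc, ?_⟩
  set B := Metric.closedBall c ρ
  have hvt : volume B ≠ ⊤ := by rw [volume_ball c hρ]; exact ENNReal.ofReal_ne_top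
  have h1 : ∫⁻ y in B, ENNReal.ofReal |f y| ≤
      (∫⁻ y in B, ENNReal.ofReal |{y | t < 2 * |f y|}.indicator f y|) +
        ENNReal.ofReal (t / 2) * volume B := by
    rw [← setLIntegral_const, ← lintegral_add_right _ measurable_const]
    refine lintegral_mono fun y => ?_
    by_cases hy : t < 2 * |f y|
    · rw [Set.indicator_of_mem (by exact hy)]; exact le_self_add
    · rw [Set.indicator_of_notMem (by exact hy)]
      refine le_add_left (ENNReal.ofReal_le_ofReal (by linarith))
  have h2 : ENNReal.ofReal t * volume B = ENNReal.ofReal (t / 2) * volume B +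
      ENNReal.ofReal (t / 2) * volume B := by
    rw [← add_mul, ← ENNReal.ofReal_add (by linarith) (by linarith)]; ring_nf
  rw [h2] at h
  exact lt_of_add_lt_add_right (h.trans_le h1)

/-- weak-type estimate with truncation -/
lemma weak_trunc {n : ℕ} {Φ : (Fin n → ℝ) → ℝ} (hΦ : Measurable Φ) {q : ℝ} (hq : 1 < q)
    (hA : AqCond q Φ) {f : (Fin n → ℝ) → ℝ} (hf : Measurable f) {t : ℝ} (ht : 0 < t) :
    ENNReal.ofReal ((t / 2) ^ q) * wmu Φ {x | ENNReal.ofReal t < maximalE f x} ≤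
      ENNReal.ofReal (KK n q) *
        ((wmu Φ).withDensity fun y => ENNReal.ofReal (|f y| ^ q)) {y | t < 2 * |f y|} := by
  have hq0 : 0 < q := by linarith
  have hS : MeasurableSet {y | t < 2 * |f y|} :=
    measurableSet_lt measurable_const (hf.abs.const_mul 2)
  have h := weak_type hΦ hq hA (hf.indicator hS) (ENNReal.ofReal (t / 2))
  rw [ENNReal.ofReal_rpow_of_pos (by linarith)] at h
  have e : ∫⁻ y, ENNReal.ofReal |{y | t < 2 * |f y|}.indicator f y| ^ q ∂(wmu Φ) =
      ((wmu Φ).withDensity fun y => ENNReal.ofReal (|f y| ^ q)) {y | t < 2 * |f y|} := by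
    rw [withDensity_apply _ hS, ← lintegral_indicator hS]
    refine lintegral_congr fun y => ?_
    by_cases hy : y ∈ {y | t < 2 * |f y|}
    · rw [Set.indicator_of_mem hy, Set.indicator_of_mem hy,
        ENNReal.ofReal_rpow_of_nonneg (abs_nonneg _) hq0.le]
    · rw [Set.indicator_of_notMem hy, Set.indicator_of_notMem hy]
      simp [hq0]
  rw [← e]
  refine le_trans ?_ h
  exact mul_le_mul_right (measure_mono fun x hx => maximalE_split hf ht x hx) _

def CS (n : ℕ) (p q : ℝ) : ℝ := p * (KK n q * 2 ^ q) / (p - q) * 2 ^ (p - q)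

lemma strong_type {n : ℕ} {Φ : (Fin n → ℝ) → ℝ} (hΦ : Measurable Φ) {q p : ℝ} (hq : 1 < q)
    (hqp : q < p) (hA : AqCond q Φ) {f : (Fin n → ℝ) → ℝ} (hf : Measurable f) :
    ∫⁻ x, ENNReal.ofReal (maximal f x ^ p) ∂(wmu Φ) ≤
      ENNReal.ofReal (CS n p q) * ∫⁻ x, ENNReal.ofReal (|f x| ^ p) ∂(wmu Φ) := by
  have hq0 : 0 < q := by linarith
  have hp0 : 0 < p := by linarith
  have hpq : 0 < p - q := by linarith
  have hK : 0 < KK n q := by unfold KK; positivity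
  have hmeas : Measurable (maximal f) := (measurable_maximalE f).ennreal_toReal
  have hfq : Measurable fun y => ENNReal.ofReal (|f y| ^ q) :=
    (hf.abs.pow_const q).ennreal_ofReal
  rw [lintegral_rpow_eq_lintegral_meas_lt_mul (wmu Φ) (f := maximal f)
    (Eventually.of_forall fun x => ENNReal.toReal_nonneg) hmeas.aemeasurable hp0]
  set ν := (wmu Φ).withDensity fun y => ENNReal.ofReal (|f y| ^ q) with hν
  have hlc := lintegral_rpow_eq_lintegral_meas_lt_mul ν (f := fun y => 2 * |f y|)
    (Eventually.of_forall fun x => by positivity) (hf.abs.const_mul 2).aemeasurable hpq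
  have hpt : ∀ t ∈ Set.Ioi (0 : ℝ), wmu Φ {x | t < maximal f x} * ENNReal.ofReal (t ^ (p - 1)) ≤
      ENNReal.ofReal (KK n q * 2 ^ q) *
        (ν {y | t < 2 * |f y|} * ENNReal.ofReal (t ^ (p - q - 1))) := by
    intro t ht
    have ht : 0 < t := ht
    have h := weak_trunc hΦ hq hA hf ht
    have hsub : wmu Φ {x | t < maximal f x} ≤ wmu Φ {x | ENNReal.ofReal t < maximalE f x} := by
      refine measure_mono fun x hx => ?_
      have hx : t < (maximalE f x).toReal := hx
      exact ((ENNReal.ofReal_lt_ofReal_iff (ht.trans hx)).2 hx).trans_le ENNReal.ofReal_toReal_le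
    have e : t ^ (p - 1) = 2 ^ q * t ^ (p - q - 1) * (t / 2) ^ q := by
      rw [Real.div_rpow ht.le (by norm_num), show p - 1 = (p - q - 1) + q by ring,
        Real.rpow_add ht]
      field_simp
    rw [e, ENNReal.ofReal_mul (by positivity), ENNReal.ofReal_mul (by positivity),
      ENNReal.ofReal_mul hK.le]
    calc _ = ENNReal.ofReal (2 ^ q) * ENNReal.ofReal (t ^ (p - q - 1)) *
          (ENNReal.ofReal ((t / 2) ^ q) * wmu Φ {x | t < maximal f x}) := by ring
      _ ≤ ENNReal.ofReal (2 ^ q) * ENNReal.ofReal (t ^ (p - q - 1)) *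
          (ENNReal.ofReal (KK n q) * ν {y | t < 2 * |f y|}) := by
          exact mul_le_mul_right ((mul_le_mul_right hsub _).trans h) _
      _ = _ := by ring
  have hitg : ∫⁻ t in Set.Ioi (0 : ℝ), wmu Φ {x | t < maximal f x} * ENNReal.ofReal (t ^ (p - 1)) ≤
      ENNReal.ofReal (KK n q * 2 ^ q) * ∫⁻ t in Set.Ioi (0 : ℝ),
        (ν {y | t < 2 * |f y|} * ENNReal.ofReal (t ^ (p - q - 1))) := by
    rw [← lintegral_const_mul' _ _ ENNReal.ofReal_ne_top]
    exact setLIntegral_mono' measurableSet_Ioi hpt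
  have hI : ∫⁻ t in Set.Ioi (0 : ℝ), (ν {y | t < 2 * |f y|} * ENNReal.ofReal (t ^ (p - q - 1))) =
      ENNReal.ofReal (1 / (p - q)) * (ENNReal.ofReal (2 ^ (p - q)) *
        ∫⁻ x, ENNReal.ofReal (|f x| ^ p) ∂(wmu Φ)) := by
    have e : ∫⁻ ω, ENNReal.ofReal ((2 * |f ω|) ^ (p - q)) ∂ν = ENNReal.ofReal (2 ^ (p - q)) *
        ∫⁻ x, ENNReal.ofReal (|f x| ^ p) ∂(wmu Φ) := by
      rw [hν, lintegral_withDensity_eq_lintegral_mul _ hfq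
        (((hf.abs.const_mul 2).pow_const _).ennreal_ofReal),
        ← lintegral_const_mul' _ _ ENNReal.ofReal_ne_top]
      refine lintegral_congr fun x => ?_
      simp only [Pi.mul_apply]
      rw [← ENNReal.ofReal_mul (by positivity), ← ENNReal.ofReal_mul (by positivity)]
      congr 1
      rw [Real.mul_rpow (by norm_num) (abs_nonneg _)]
      have : |f x| ^ p = |f x| ^ q * |f x| ^ (p - q) := by
        rw [← Real.rpow_add_of_nonneg (abs_nonneg _) hq0.le hpq.le]; ring_nf
      rw [this]; ring
    rw [← e, hlc, ← mul_assoc, ← ENNReal.ofReal_mul (by positivity), one_div_mul_cancel hpq.ne']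
    simp
  refine (mul_le_mul_right hitg _).trans (le_of_eq ?_)
  rw [hI, CS, show p * (KK n q * 2 ^ q) / (p - q) * 2 ^ (p - q) =
    p * ((KK n q * 2 ^ q) * (1 / (p - q) * 2 ^ (p - q))) by ring,
    ENNReal.ofReal_mul hp0.le, ENNReal.ofReal_mul (p := KK n q * 2 ^ q) (by positivity),
    ENNReal.ofReal_mul (p := 1 / (p - q)) (by positivity)]
  ring

lemma ae_finite {n : ℕ} {Φ : (Fin n → ℝ) → ℝ} (hΦ : Measurable Φ) {q p : ℝ} (hq : 1 < q)
    (hqp : q < p) (hA : AqCond q Φ) {f : (Fin n → ℝ) → ℝ} (hf : Measurable f)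
    (hfin : ∫⁻ x, ENNReal.ofReal (|f x| ^ p) ∂(wmu Φ) ≠ ⊤) :
    ∀ᵐ x ∂(volume : Measure (Fin n → ℝ)), maximalE f x ≠ ⊤ := by
  have hq0 : 0 < q := by linarith
  have hp0 : 0 < p := by linarith
  have hpq : 0 < p - q := by linarith
  have hac : (volume : Measure (Fin n → ℝ)) ≪ wmu Φ :=
    withDensity_absolutelyContinuous' hΦ.exp.ennreal_ofReal.aemeasurable
      (Eventually.of_forall fun x => by simp [Real.exp_pos])
  refine hac.ae_le ?_
  show ∀ᵐ x ∂(wmu Φ), maximalE f x ≠ ⊤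
  rw [ae_iff]
  simp only [ne_eq, not_not]
  have hfq : Measurable fun y => ENNReal.ofReal (|f y| ^ q) :=
    (hf.abs.pow_const q).ennreal_ofReal
  set M := ENNReal.ofReal (KK n q) * ∫⁻ x, ENNReal.ofReal (|f x| ^ p) ∂(wmu Φ) with hM
  have hMt : M ≠ ⊤ := ENNReal.mul_ne_top ENNReal.ofReal_ne_top hfin
  by_contra h0
  obtain ⟨k, hk⟩ := ENNReal.exists_nat_mul_gt h0 hMt
  have hk1 : (1 : ℝ) ≤ k := by
    rcases Nat.eq_zero_or_pos k with h | h
    · rw [h] at hk; simp at hk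
    · exact_mod_cast h
  have hk0 : (0 : ℝ) < k := by linarith
  have hw := weak_trunc hΦ hq hA hf (t := 2 * k) (by linarith)
  rw [mul_div_cancel_left₀ _ (two_ne_zero)] at hw
  have hsub : wmu Φ {a | maximalE f a = ⊤} ≤
      wmu Φ {x | ENNReal.ofReal (2 * k) < maximalE f x} := by
    refine measure_mono fun x hx => ?_
    have hx : maximalE f x = ⊤ := hx
    simp only [Set.mem_ofPred_eq, hx]; exact ENNReal.ofReal_lt_top
  have hS : MeasurableSet {y | 2 * (k : ℝ) < 2 * |f y|} :=
    measurableSet_lt measurable_const (hf.abs.const_mul 2)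
  have hch : ENNReal.ofReal ((k : ℝ) ^ (p - q)) *
      ((wmu Φ).withDensity fun y => ENNReal.ofReal (|f y| ^ q)) {y | 2 * (k : ℝ) < 2 * |f y|} ≤
      ∫⁻ x, ENNReal.ofReal (|f x| ^ p) ∂(wmu Φ) := by
    rw [withDensity_apply _ hS, ← lintegral_const_mul' _ _ ENNReal.ofReal_ne_top]
    refine le_trans ?_ (setLIntegral_le_lintegral {y | 2 * (k : ℝ) < 2 * |f y|} _)
    refine setLIntegral_mono' hS fun y hy => ?_
    have hy : 2 * (k : ℝ) < 2 * |f y| := hy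
    rw [← ENNReal.ofReal_mul (by positivity)]
    refine ENNReal.ofReal_le_ofReal ?_
    have : |f y| ^ p = |f y| ^ (p - q) * |f y| ^ q := by
      rw [← Real.rpow_add_of_nonneg (abs_nonneg _) hpq.le hq0.le]; ring_nf
    rw [this]
    gcongr
    linarith
  have hkp : (k : ℝ≥0∞) ≤ ENNReal.ofReal ((k : ℝ) ^ (p - q)) * ENNReal.ofReal ((k : ℝ) ^ q) := by
    rw [← ENNReal.ofReal_mul (by positivity), ← Real.rpow_add hk0, ← ENNReal.ofReal_natCast]
    refine ENNReal.ofReal_le_ofReal ?_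
    calc (k : ℝ) = (k : ℝ) ^ (1 : ℝ) := (Real.rpow_one _).symm
      _ ≤ _ := Real.rpow_le_rpow_of_exponent_le hk1 (by linarith)
  refine absurd hk (not_lt.2 ?_)
  calc (k : ℝ≥0∞) * wmu Φ {a | maximalE f a = ⊤} ≤
      (ENNReal.ofReal ((k : ℝ) ^ (p - q)) * ENNReal.ofReal ((k : ℝ) ^ q)) *
        wmu Φ {x | ENNReal.ofReal (2 * k) < maximalE f x} := mul_le_mul' hkp hsub
    _ = ENNReal.ofReal ((k : ℝ) ^ (p - q)) * (ENNReal.ofReal ((k : ℝ) ^ q) *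
        wmu Φ {x | ENNReal.ofReal (2 * k) < maximalE f x}) := by ring
    _ ≤ _ := mul_le_mul_right hw _
    _ = ENNReal.ofReal (KK n q) * (ENNReal.ofReal ((k : ℝ) ^ (p - q)) *
      ((wmu Φ).withDensity fun y => ENNReal.ofReal (|f y| ^ q)) {y | 2 * (k : ℝ) < 2 * |f y|}) := by
        ring
    _ ≤ _ := mul_le_mul_right hch _

lemma maximalE_interp {n : ℕ} {f f0 f1 : (Fin n → ℝ) → ℝ} (hf0 : Measurable f0)
    (hf1 : Measurable f1) {θ : ℝ} (hθ0 : 0 ≤ θ) (hθ1 : θ ≤ 1)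
    (h : ∀ x, |f x| = |f0 x| ^ (1 - θ) * |f1 x| ^ θ) (x : Fin n → ℝ) :
    maximalE f x ≤ maximalE f0 x ^ (1 - θ) * maximalE f1 x ^ θ := by
  have h1θ : 0 ≤ 1 - θ := by linarith
  refine iSup_le fun Q => iSup_le fun hQ => iSup_le fun hx => ?_
  have hle : ∀ g : (Fin n → ℝ) → ℝ, avg Q (fun y => |g y|) ≤ maximalE g x := fun g =>
    le_iSup_of_le Q (le_iSup_of_le hQ (le_iSup_of_le hx le_rfl))
  refine le_trans ?_ (mul_le_mul' (ENNReal.rpow_le_rpow (hle f0) h1θ)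
    (ENNReal.rpow_le_rpow (hle f1) hθ0))
  obtain ⟨c, ρ, hρ, rfl⟩ := (isCube_iff Q).1 hQ
  have hol := ENNReal.lintegral_mul_norm_pow_le (μ := volume.restrict (Metric.closedBall c ρ))
    (f := fun x => ENNReal.ofReal |f0 x|) (g := fun x => ENNReal.ofReal |f1 x|)
    hf0.abs.ennreal_ofReal.aemeasurable hf1.abs.ennreal_ofReal.aemeasurable
    h1θ hθ0 (by ring)
  have e : ∀ x, ENNReal.ofReal |f x| = ENNReal.ofReal |f0 x| ^ (1 - θ) *
      ENNReal.ofReal |f1 x| ^ θ := by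
    intro x
    rw [h x, ENNReal.ofReal_mul (by positivity),
      ENNReal.ofReal_rpow_of_nonneg (abs_nonneg _) h1θ,
      ENNReal.ofReal_rpow_of_nonneg (abs_nonneg _) hθ0]
  simp only [← e] at hol
  have hv0 : volume (Metric.closedBall c ρ) ≠ 0 := by
    rw [volume_ball c hρ]; simp only [ne_eq, ENNReal.ofReal_eq_zero, not_le]; positivity
  have hvt : volume (Metric.closedBall c ρ) ≠ ⊤ := by
    rw [volume_ball c hρ]; exact ENNReal.ofReal_ne_top
  unfold avg
  rw [ENNReal.div_rpow_of_nonneg _ _ h1θ, ENNReal.div_rpow_of_nonneg _ _ hθ0]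
  set v := volume (Metric.closedBall c ρ)
  have hvv : v⁻¹ = (v ^ (1 - θ))⁻¹ * (v ^ θ)⁻¹ := by
    rw [← ENNReal.rpow_neg, ← ENNReal.rpow_neg, ← ENNReal.rpow_add _ _ hv0 hvt,
      ← ENNReal.rpow_neg_one]
    congr 1; ring
  calc _ = (∫⁻ x in Metric.closedBall c ρ, ENNReal.ofReal |f x|) * v⁻¹ := div_eq_mul_inv _ _
    _ ≤ _ := mul_le_mul_left hol _
    _ = _ := by rw [hvv, div_eq_mul_inv, div_eq_mul_inv]; ring

lemma norm_le_iff (A B : ℝ≥0∞) {c p : ℝ} (hc : 0 ≤ c) (hp : 0 < p) :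
    A ^ (1 / p) ≤ ENNReal.ofReal c * B ^ (1 / p) ↔ A ≤ ENNReal.ofReal (c ^ p) * B := by
  have : ENNReal.ofReal c = ENNReal.ofReal (c ^ p) ^ (1 / p) := by
    rw [ENNReal.ofReal_rpow_of_nonneg (by positivity) (by positivity), ← Real.rpow_mul hc,
      mul_one_div_cancel hp.ne', Real.rpow_one]
  rw [this, ← ENNReal.mul_rpow_of_nonneg _ _ (by positivity),
    ENNReal.rpow_le_rpow_iff (by positivity)]

lemma lintegral_wmu {n : ℕ} {Φ : (Fin n → ℝ) → ℝ} (hΦ : Measurable Φ)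
    {g : (Fin n → ℝ) → ℝ≥0∞} (hg : Measurable g) :
    ∫⁻ x, g x ∂(wmu Φ) = ∫⁻ x, g x * ENNReal.ofReal (Real.exp (Φ x)) := by
  rw [wmu, lintegral_withDensity_eq_lintegral_mul _ hΦ.exp.ennreal_ofReal hg]
  simp [mul_comm]

lemma aqCond_zero {n : ℕ} {q : ℝ} (hq : 1 < q) : AqCond q (fun _ : Fin n → ℝ => (0 : ℝ)) := by
  have h := aqCond_of_var (n := n) (φ := fun _ => (0 : ℝ)) (V := 0)
    (fun a r _ => ⟨integrableOn_zero, by simp [integrableOn_zero], by simp [hmean]⟩) hq 1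
    (by norm_num) (by norm_num)
  simpa using h

lemma lintegral_wmu_zero {n : ℕ} (g : (Fin n → ℝ) → ℝ≥0∞) :
    ∫⁻ x, g x ∂(wmu (fun _ => (0 : ℝ))) = ∫⁻ x, g x := by
  simp [wmu]

lemma maximal_nonneg {n : ℕ} (f : (Fin n → ℝ) → ℝ) (x : Fin n → ℝ) : 0 ≤ maximal f x :=
  ENNReal.toReal_nonneg

lemma CS_pos (n : ℕ) {p q : ℝ} (hq : 1 < q) (hqp : q < p) : 0 < CS n p q := by
  have : 0 < p - q := by linarith
  have : 0 < p := by linarith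
  unfold CS KK; positivity

lemma interp {n : ℕ} {φ : (Fin n → ℝ) → ℝ} (hφ : Measurable φ) {p q θ : ℝ} (hq : 1 < q)
    (hqp : q < p) (hθ0 : 0 < θ) (hθ1 : θ ≤ 1) (hA : AqCond q (fun x => 1 / θ * φ x))
    {c : ℝ} (hc : 0 ≤ c) (hS : StrongBound p (fun _ : Fin n → ℝ => (1 : ℝ)) maximal c) :
    StrongBound p (fun x => Real.exp (φ x)) maximal
      (c ^ (1 - θ) * (CS n p q ^ (1 / p)) ^ θ) := by
  have hp0 : 0 < p := by linarith
  have h1θ : 0 ≤ 1 - θ := by linarith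
  have hCS := CS_pos n hq hqp
  rintro f ⟨hf, hfin⟩
  have hΦ : Measurable (fun x => 1 / θ * φ x) := hφ.const_mul _
  set f0 : (Fin n → ℝ) → ℝ := fun x => |f x| * Real.exp (φ x / p) with hf0
  set f1 : (Fin n → ℝ) → ℝ := fun x => |f x| * Real.exp (φ x / p - φ x / (θ * p)) with hf1
  have mf0 : Measurable f0 := hf.abs.mul (hφ.div_const p).exp
  have mf1 : Measurable f1 := hf.abs.mul ((hφ.div_const p).sub (hφ.div_const _)).exp
  have a0 : ∀ x, |f0 x| = |f x| * Real.exp (φ x / p) := fun x => by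
    rw [hf0, abs_of_nonneg (by positivity)]
  have a1 : ∀ x, |f1 x| = |f x| * Real.exp (φ x / p - φ x / (θ * p)) := fun x => by
    rw [hf1, abs_of_nonneg (by positivity)]
  have hsplit : ∀ x, |f x| = |f0 x| ^ (1 - θ) * |f1 x| ^ θ := by
    intro x
    rw [a0, a1, Real.mul_rpow (abs_nonneg _) (Real.exp_pos _).le,
      Real.mul_rpow (abs_nonneg _) (Real.exp_pos _).le, ← Real.exp_mul, ← Real.exp_mul]
    have e1 : |f x| ^ (1 - θ) * |f x| ^ θ = |f x| := by
      rw [← Real.rpow_add_of_nonneg (abs_nonneg _) h1θ hθ0.le]; simp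
    have e2 : Real.exp (φ x / p * (1 - θ)) * Real.exp ((φ x / p - φ x / (θ * p)) * θ) = 1 := by
      rw [← Real.exp_add, Real.exp_eq_one_iff]; field_simp; ring
    calc |f x| = (|f x| ^ (1 - θ) * |f x| ^ θ) *
        (Real.exp (φ x / p * (1 - θ)) * Real.exp ((φ x / p - φ x / (θ * p)) * θ)) := by
          rw [e1, e2, mul_one]
      _ = _ := by ring
  set J := ∫⁻ x, ENNReal.ofReal (|f x| ^ p) * ENNReal.ofReal (Real.exp (φ x)) with hJ
  have hJt : J ≠ ⊤ := by
    intro h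
    apply hfin
    rw [eLpNormW, ← hJ, h, ENNReal.top_rpow_of_pos (by positivity)]
  have J0 : ∫⁻ x, ENNReal.ofReal (|f0 x| ^ p) = J := by
    refine lintegral_congr fun x => ?_
    rw [← ENNReal.ofReal_mul (by positivity), a0,
      Real.mul_rpow (abs_nonneg _) (Real.exp_pos _).le, ← Real.exp_mul,
      div_mul_cancel₀ _ hp0.ne']
  have J1 : ∫⁻ x, ENNReal.ofReal (|f1 x| ^ p) ∂(wmu (fun x => 1 / θ * φ x)) = J := by
    rw [lintegral_wmu hΦ (mf1.abs.pow_const p).ennreal_ofReal]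
    refine lintegral_congr fun x => ?_
    rw [← ENNReal.ofReal_mul (by positivity), ← ENNReal.ofReal_mul (by positivity), a1,
      Real.mul_rpow (abs_nonneg _) (Real.exp_pos _).le, ← Real.exp_mul, mul_assoc,
      ← Real.exp_add]
    congr 4
    field_simp; ring
  have fin0 := ae_finite measurable_const hq hqp (aqCond_zero hq) mf0
    (by rw [lintegral_wmu_zero, J0]; exact hJt)
  have fin1 := ae_finite hΦ hq hqp hA mf1 (by rw [J1]; exact hJt)
  have B0 : ∫⁻ x, ENNReal.ofReal (maximal f0 x ^ p) ≤ ENNReal.ofReal (c ^ p) * J := by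
    have hm : MemLpW p (fun _ : Fin n → ℝ => (1 : ℝ)) f0 := by
      refine ⟨mf0, ?_⟩
      rw [eLpNormW]
      simp only [ENNReal.ofReal_one, mul_one, J0]
      exact ENNReal.rpow_ne_top_of_nonneg (by positivity) hJt
    have h := hS f0 hm
    unfold eLpNormW at h
    rw [norm_le_iff _ _ hc hp0] at h
    simpa only [ENNReal.ofReal_one, mul_one, J0, abs_of_nonneg (maximal_nonneg _ _)] using h
  have B1 := strong_type hΦ hq hqp hA mf1
  rw [J1, lintegral_wmu hΦ (g := fun x => ENNReal.ofReal (maximal f1 x ^ p))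
    (((measurable_maximalE f1).ennreal_toReal.pow_const p).ennreal_ofReal)] at B1
  have hpt : ∀ᵐ x, ENNReal.ofReal (|maximal f x| ^ p) * ENNReal.ofReal (Real.exp (φ x)) ≤
      ENNReal.ofReal (maximal f0 x ^ p) ^ (1 - θ) * (ENNReal.ofReal (maximal f1 x ^ p) *
        ENNReal.ofReal (Real.exp (1 / θ * φ x))) ^ θ := by
    filter_upwards [fin0, fin1] with x h0 h1
    have hm := maximalE_interp mf0 mf1 hθ0.le hθ1 hsplit x
    have hm' : maximal f x ≤ maximal f0 x ^ (1 - θ) * maximal f1 x ^ θ := by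
      have := ENNReal.toReal_mono (ENNReal.mul_ne_top
        (ENNReal.rpow_ne_top_of_nonneg h1θ h0) (ENNReal.rpow_ne_top_of_nonneg hθ0.le h1)) hm
      rwa [ENNReal.toReal_mul, ← ENNReal.toReal_rpow, ← ENNReal.toReal_rpow] at this
    have n0 := maximal_nonneg f0 x
    have n1 := maximal_nonneg f1 x
    rw [abs_of_nonneg (maximal_nonneg _ _), ← ENNReal.ofReal_mul
      (Real.rpow_nonneg (maximal_nonneg _ _) _), ← ENNReal.ofReal_mul (by positivity),
      ENNReal.ofReal_rpow_of_nonneg (by positivity) h1θ,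
      ENNReal.ofReal_rpow_of_nonneg (by positivity) hθ0.le, ← ENNReal.ofReal_mul (by positivity)]
    refine ENNReal.ofReal_le_ofReal ?_
    have h2 := Real.rpow_le_rpow (maximal_nonneg f x) hm' hp0.le
    rw [Real.mul_rpow (by positivity) (Real.exp_pos _).le, ← Real.exp_mul,
      show 1 / θ * φ x * θ = φ x by field_simp, ← mul_assoc]
    refine mul_le_mul_of_nonneg_right (h2.trans (le_of_eq ?_)) (Real.exp_pos _).le
    rw [Real.mul_rpow (by positivity) (by positivity), ← Real.rpow_mul n0, ← Real.rpow_mul n1,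
      ← Real.rpow_mul n0, ← Real.rpow_mul n1, mul_comm p, mul_comm p]
  unfold eLpNormW
  rw [norm_le_iff _ _ (by positivity) hp0]
  have hol := ENNReal.lintegral_mul_norm_pow_le (μ := (volume : Measure (Fin n → ℝ)))
    (f := fun x => ENNReal.ofReal (maximal f0 x ^ p))
    (g := fun x => ENNReal.ofReal (maximal f1 x ^ p) * ENNReal.ofReal (Real.exp (1 / θ * φ x)))
    (((measurable_maximalE f0).ennreal_toReal.pow_const p).ennreal_ofReal).aemeasurable
    ((((measurable_maximalE f1).ennreal_toReal.pow_const p).ennreal_ofReal).mul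
      hΦ.exp.ennreal_ofReal).aemeasurable h1θ hθ0.le (by ring)
  calc _ ≤ _ := lintegral_mono_ae hpt
    _ ≤ _ := hol
    _ ≤ (ENNReal.ofReal (c ^ p) * J) ^ (1 - θ) * (ENNReal.ofReal (CS n p q) * J) ^ θ :=
        mul_le_mul' (ENNReal.rpow_le_rpow B0 h1θ) (ENNReal.rpow_le_rpow B1 hθ0.le)
    _ = (ENNReal.ofReal (c ^ p) ^ (1 - θ) * ENNReal.ofReal (CS n p q) ^ θ) *
        (J ^ (1 - θ) * J ^ θ) := by
        rw [ENNReal.mul_rpow_of_nonneg _ _ h1θ, ENNReal.mul_rpow_of_nonneg _ _ hθ0.le]; ring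
    _ = ENNReal.ofReal ((c ^ (1 - θ) * (CS n p q ^ (1 / p)) ^ θ) ^ p) * J := by
        rw [← ENNReal.rpow_add_of_nonneg _ _ h1θ hθ0.le]
        simp only [sub_add_cancel, ENNReal.rpow_one]
        rw [ENNReal.ofReal_rpow_of_nonneg (by positivity) h1θ,
          ENNReal.ofReal_rpow_of_nonneg (by positivity) hθ0.le,
          ← ENNReal.ofReal_mul (by positivity)]
        congr 2
        rw [Real.mul_rpow (by positivity) (by positivity), ← Real.rpow_mul hc, ← Real.rpow_mul hc,
          ← Real.rpow_mul hCS.le, ← Real.rpow_mul hCS.le, mul_comm p]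
        congr 2
        field_simp

lemma strong_one {n : ℕ} {p q : ℝ} (hq : 1 < q) (hqp : q < p) :
    StrongBound p (fun _ : Fin n → ℝ => (1 : ℝ)) maximal (CS n p q ^ (1 / p)) := by
  have hp0 : 0 < p := by linarith
  have hCS := CS_pos n hq hqp
  rintro f ⟨hf, _⟩
  unfold eLpNormW
  rw [norm_le_iff _ _ (by positivity) hp0, ← Real.rpow_mul hCS.le, one_div_mul_cancel hp0.ne',
    Real.rpow_one]
  have h := strong_type measurable_const hq hqp (aqCond_zero hq) hf
  rw [lintegral_wmu_zero, lintegral_wmu_zero] at h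
  simpa only [ENNReal.ofReal_one, mul_one, abs_of_nonneg (maximal_nonneg _ _)] using h

lemma one_le_bound {n : ℕ} {p q : ℝ} (hq : 1 < q) (hqp : q < p) {c : ℝ} (hc : 0 ≤ c)
    (hS : StrongBound p (fun _ : Fin n → ℝ => (1 : ℝ)) maximal c) : 1 ≤ c := by
  have hp0 : 0 < p := by linarith
  set Q : Set (Fin n → ℝ) := Metric.closedBall 0 1 with hQ
  have hQm : MeasurableSet Q := Metric.isClosed_closedBall.measurableSet
  have hv0 : volume Q ≠ 0 := by
    rw [hQ, volume_ball _ one_pos]; simp only [ne_eq, ENNReal.ofReal_eq_zero, not_le]; positivity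
  have hvt : volume Q ≠ ⊤ := by
    rw [hQ, volume_ball _ one_pos]; exact ENNReal.ofReal_ne_top
  set f : (Fin n → ℝ) → ℝ := Q.indicator 1 with hf
  have mf : Measurable f := measurable_one.indicator hQm
  have e1 : ∀ x, ENNReal.ofReal (|f x| ^ p) = Q.indicator 1 x := by
    intro x
    by_cases hx : x ∈ Q
    · simp [hf, hx]
    · simp [hf, hx, Real.zero_rpow hp0.ne']
  have e2 : ∀ x, ENNReal.ofReal |f x| = Q.indicator 1 x := by
    intro x
    by_cases hx : x ∈ Q
    · simp [hf, hx]
    · simp [hf, hx]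
  have I1 : ∫⁻ x, ENNReal.ofReal (|f x| ^ p) = volume Q := by
    simp only [e1]; exact lintegral_indicator_one hQm
  have hfin := ae_finite measurable_const hq hqp (aqCond_zero hq) mf
    (by rw [lintegral_wmu_zero, I1]; exact hvt)
  have h := hS f ⟨mf, by
    rw [eLpNormW]
    simp only [ENNReal.ofReal_one, mul_one, I1]
    exact ENNReal.rpow_ne_top_of_nonneg (by positivity) hvt⟩
  unfold eLpNormW at h
  rw [norm_le_iff _ _ hc hp0] at h
  simp only [ENNReal.ofReal_one, mul_one, I1] at h
  have hlow : volume Q ≤ ∫⁻ x, ENNReal.ofReal (|maximal f x| ^ p) := by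
    rw [← lintegral_indicator_one hQm]
    refine lintegral_mono_ae ?_
    filter_upwards [hfin] with x hx
    by_cases hxQ : x ∈ Q
    · have h1 : 1 ≤ maximalE f x := by
        refine le_iSup_of_le Q (le_iSup_of_le ((isCube_iff Q).2 ⟨0, 1, one_pos, rfl⟩)
          (le_iSup_of_le hxQ ?_))
        unfold avg
        simp only [e2]
        rw [lintegral_indicator_one hQm, Measure.restrict_apply hQm, Set.inter_self,
          ENNReal.div_self hv0 hvt]
      have h2 : 1 ≤ maximal f x := by
        have := ENNReal.toReal_mono hx h1
        simpa [maximal] using this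
      rw [Set.indicator_of_mem hxQ, abs_of_nonneg (by linarith), Pi.one_apply,
        ← ENNReal.ofReal_one]
      exact ENNReal.ofReal_le_ofReal (Real.one_le_rpow h2 hp0.le)
    · rw [Set.indicator_of_notMem hxQ]; exact zero_le
  have h3 : 1 * volume Q ≤ ENNReal.ofReal (c ^ p) * volume Q := by
    rw [one_mul]; exact hlow.trans h
  rw [ENNReal.mul_le_mul_iff_left hv0 hvt, ← ENNReal.ofReal_one,
    ENNReal.ofReal_le_ofReal_iff (by positivity)] at h3
  by_contra hlt
  exact absurd h3 (not_le.2 (Real.rpow_lt_one hc (not_le.1 hlt) hp0))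

def C2 (n : ℕ) (p q : ℝ) : ℝ := max 1 (CS n p q ^ (1 / p))

lemma flat_core {n : ℕ} {φ : (Fin n → ℝ) → ℝ} (hφ : Measurable φ) {p q θ : ℝ} (hq : 1 < q)
    (hqp : q < p) (hθ0 : 0 < θ) (hθ1 : θ ≤ 1) (hA : AqCond q (fun x => 1 / θ * φ x)) :
    opNorm p (fun x => Real.exp (φ x)) maximal ≤
      opNorm p (fun _ : Fin n → ℝ => (1 : ℝ)) maximal * (1 + C2 n p q * θ) := by
  have hCS := CS_pos n hq hqp
  have hC2 : 1 ≤ C2 n p q := le_max_left _ _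
  have hpos : 0 < 1 + C2 n p q * θ := by nlinarith
  have hbern : (CS n p q ^ (1 / p)) ^ θ ≤ 1 + C2 n p q * θ := by
    have h1 : (CS n p q ^ (1 / p)) ^ θ ≤ (C2 n p q) ^ θ :=
      Real.rpow_le_rpow (by positivity) (le_max_right _ _) hθ0.le
    have h2 := rpow_one_add_le_one_add_mul_self (s := C2 n p q - 1) (by linarith) hθ0.le hθ1
    rw [add_sub_cancel] at h2
    nlinarith
  rw [← div_le_iff₀ hpos]
  refine le_csInf ⟨_, (by positivity : (0 : ℝ) ≤ CS n p q ^ (1 / p)), strong_one hq hqp⟩ ?_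
  rintro c ⟨hc, hS⟩
  rw [div_le_iff₀ hpos]
  have hc1 := one_le_bound hq hqp hc hS
  have hin := interp hφ hq hqp hθ0 hθ1 hA hc hS
  have hle : opNorm p (fun x => Real.exp (φ x)) maximal ≤
      c ^ (1 - θ) * (CS n p q ^ (1 / p)) ^ θ :=
    csInf_le ⟨0, fun _ h => h.1⟩ ⟨by positivity, hin⟩
  refine hle.trans (mul_le_mul ?_ hbern (by positivity) hc)
  calc c ^ (1 - θ) ≤ c ^ (1 : ℝ) := Real.rpow_le_rpow_of_exponent_le hc1 (by linarith)
    _ = c := Real.rpow_one c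

lemma opNorm_congr {n : ℕ} {p : ℝ} {w w' : (Fin n → ℝ) → ℝ} (h : w =ᵐ[volume] w')
    (T : ((Fin n → ℝ) → ℝ) → (Fin n → ℝ) → ℝ) : opNorm p w T = opNorm p w' T := by
  have : eLpNormW p w = eLpNormW p w' := by
    funext f
    unfold eLpNormW
    congr 1
    refine lintegral_congr_ae ?_
    filter_upwards [h] with x hx
    rw [hx]
  unfold opNorm StrongBound MemLpW
  rw [this]

lemma avg_congr {n : ℕ} {f g : (Fin n → ℝ) → ℝ} (h : f =ᵐ[volume] g) (Q : Set (Fin n → ℝ)) :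
    avg Q f = avg Q g := by
  unfold avg
  congr 1
  refine lintegral_congr_ae (ae_restrict_of_ae ?_)
  filter_upwards [h] with x hx
  rw [hx]

/-- **Flat bound for the maximal function.** For `1 < p < ∞` and `n ≥ 1` there are
`δ_{n,p} > 0` and `c_{n,p} > 0`, depending only on `n` and `p`, such that for every weight
`w ∈ A_p` on `ℝⁿ` with `[w]_{A_p} ≤ 1 + δ_{n,p}`,
`‖M‖_{L^p(w) → L^p(w)} ≤ ‖M‖_{L^p → L^p} (1 + c_{n,p} √([w]_{A_p} - 1))`,
where `‖M‖_{L^p → L^p}` is the operator norm of `M` on the unweighted `L^p(ℝⁿ)`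
(i.e. with constant weight `1`). -/
theorem flat_maximal_bound
    (n : ℕ) (hn : 1 ≤ n) (p : ℝ) (hp : 1 < p) :
    ∃ δ : ℝ, 0 < δ ∧ ∃ c : ℝ, 0 < c ∧
      ∀ w : (Fin n → ℝ) → ℝ, MemAp p w → apChar p w ≤ 1 + δ →
        opNorm p w maximal
          ≤ opNorm p (fun _ : Fin n → ℝ => (1 : ℝ)) maximal *
            (1 + c * Real.sqrt (apChar p w - 1)) := by
  obtain ⟨q, hq, hqp⟩ : ∃ q : ℝ, 1 < q ∧ q < p := ⟨(1 + p) / 2, by linarith, by linarith⟩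
  have hp1 : 0 < p - 1 := by linarith
  have hq1 : 0 < q - 1 := by linarith
  have hC1 : 0 < C1 (1 / (p - 1)) := C1_pos (by positivity)
  set K2 := 16 * 2 ^ n * C1 (1 / (p - 1)) * (1 + (1 / (q - 1)) ^ 2) with hK2
  have hK2p : 0 < K2 := by positivity
  have hKp : 0 < Real.sqrt K2 := Real.sqrt_pos.2 hK2p
  have hC2 : 1 ≤ C2 n p q := le_max_left _ _
  refine ⟨min 1 (1 / (4 * K2)), by positivity, C2 n p q * Real.sqrt K2, by positivity, ?_⟩
  rintro w ⟨⟨hwpos, hwloc⟩, hwfin⟩ hδ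
  have hsm : AEStronglyMeasurable w volume := hwloc.aestronglyMeasurable
  set φ : (Fin n → ℝ) → ℝ := fun x => Real.log (hsm.mk w x) with hφd
  have hφ : Measurable φ := hsm.stronglyMeasurable_mk.measurable.log
  have hwφ : w =ᵐ[volume] fun x => Real.exp (φ x) := by
    filter_upwards [hsm.ae_eq_mk, hwpos] with x h1 h2
    rw [hφd, Real.exp_log (by rw [← h1]; exact h2), ← h1]
  have hwφ' : (fun x => w x ^ (-(1 / (p - 1)))) =ᵐ[volume]
      fun x => Real.exp (-(1 / (p - 1) * φ x)) := by
    filter_upwards [hwφ] with x hx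
    rw [hx, ← Real.exp_mul]; congr 1; ring
  set ε : ℝ := max (apChar p w - 1) 0 with hε
  have hε0 : 0 ≤ ε := le_max_right _ _
  have hεδ : ε ≤ min 1 (1 / (4 * K2)) := max_le (by linarith) (by positivity)
  have hε1 : ε ≤ 1 := hεδ.trans (min_le_left _ _)
  have hε2 : ε ≤ 1 / (4 * K2) := hεδ.trans (min_le_right _ _)
  have hsq : Real.sqrt (apChar p w - 1) = Real.sqrt ε := by
    rcases le_total (apChar p w - 1) 0 with h | h
    · rw [hε, max_eq_right h, Real.sqrt_eq_zero_of_nonpos h, Real.sqrt_zero]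
    · rw [hε, max_eq_left h]
  have hvar := var_cube hφ hp hε0 hε1
    (fun a r hr => by
      refine IntegrableOn.congr_set_ae ?_ (hc_ae_eq a r)
      exact (hwloc.integrableOn_isCompact isCompact_Icc).congr (ae_restrict_of_ae hwφ))
    (fun Q hQ => by
      rw [← avg_congr hwφ, ← avg_congr hwφ']
      have h1 : avg Q w * (avg Q (fun x => w x ^ (-(1 / (p - 1))))) ^ (p - 1) ≤ apCharE p w :=
        le_iSup_of_le Q (le_iSup_of_le hQ le_rfl)
      refine h1.trans ?_
      rw [← ENNReal.ofReal_toReal hwfin]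
      refine ENNReal.ofReal_le_ofReal ?_
      have : apChar p w - 1 ≤ ε := le_max_left _ _
      unfold apChar at this
      linarith)
  rw [opNorm_congr hwφ, hsq]
  have hKε : Real.sqrt K2 * Real.sqrt ε ≤ 1 / 2 := by
    rw [← Real.sqrt_mul hK2p.le]
    refine Real.sqrt_le_iff.2 ⟨by norm_num, ?_⟩
    rw [le_div_iff₀ (by positivity)] at hε2
    nlinarith
  have hbound : ∀ η : ℝ, 0 < η → η ≤ 1 / 2 → opNorm p (fun x => Real.exp (φ x)) maximal ≤
      opNorm p (fun _ : Fin n → ℝ => (1 : ℝ)) maximal *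
        (1 + C2 n p q * (Real.sqrt K2 * Real.sqrt ε + η)) := by
    intro η h0 h1
    set θ := Real.sqrt K2 * Real.sqrt ε + η with hθ
    have hθ0 : 0 < θ := by positivity
    have hθ1 : θ ≤ 1 := by linarith
    have hθ2 : K2 * ε ≤ θ ^ 2 := by
      have : K2 * ε = (Real.sqrt K2 * Real.sqrt ε) ^ 2 := by
        rw [mul_pow, Real.sq_sqrt hK2p.le, Real.sq_sqrt hε0]
      rw [this]
      exact pow_le_pow_left₀ (by positivity) (by linarith) 2
    have hX : 0 ≤ 16 * 2 ^ n * C1 (1 / (p - 1)) * ε := by positivity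
    have hY : 0 ≤ (1 / (q - 1)) ^ 2 := by positivity
    have hsplit : K2 * ε = 16 * 2 ^ n * C1 (1 / (p - 1)) * ε +
        16 * 2 ^ n * C1 (1 / (p - 1)) * ε * (1 / (q - 1)) ^ 2 := by rw [hK2]; ring
    refine flat_core hφ hq hqp hθ0 hθ1 (aqCond_of_var hvar hq (1 / θ) ?_ ?_)
    · have : 2 ^ n * ((1 / θ) ^ 2 * (C1 (1 / (p - 1)) * ε)) =
          (16 * 2 ^ n * C1 (1 / (p - 1)) * ε) / (16 * θ ^ 2) := by field_simp
      rw [this, div_le_iff₀ (by positivity)]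
      nlinarith [mul_nonneg hX hY]
    · have : 2 ^ n * ((1 / θ / (q - 1)) ^ 2 * (C1 (1 / (p - 1)) * ε)) =
          (16 * 2 ^ n * C1 (1 / (p - 1)) * ε * (1 / (q - 1)) ^ 2) / (16 * θ ^ 2) := by
        field_simp
      rw [this, div_le_iff₀ (by positivity)]
      nlinarith [mul_nonneg hX hY]
  have hlim : Tendsto (fun η : ℝ => opNorm p (fun _ : Fin n → ℝ => (1 : ℝ)) maximal *
        (1 + C2 n p q * (Real.sqrt K2 * Real.sqrt ε + η))) (nhdsWithin 0 (Set.Ioi 0))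
      (nhds (opNorm p (fun _ : Fin n → ℝ => (1 : ℝ)) maximal *
        (1 + C2 n p q * (Real.sqrt K2 * Real.sqrt ε + 0)))) := by
    refine Tendsto.mono_left ?_ nhdsWithin_le_nhds
    exact Continuous.tendsto (by fun_prop) 0
  have hfinal := ge_of_tendsto hlim (by
    filter_upwards [Ioc_mem_nhdsGT (show (0 : ℝ) < 1 / 2 by norm_num)] with η hη
    exact hbound η hη.1 hη.2)
  rw [add_zero, ← mul_assoc] at hfinal
  exact hfinal
end
end

section
/- (Flatness of the auxiliary weight, upward case) Let 1 < p₀ < p < ∞, let w ∈ A_p be a weight on ℝⁿ, and let u be a positive measurable function such that the product u·w is an A₁ weight. Then the weight W(x) := u(x)^{(p−p₀)/(p−1)}·w(x) belongs to A_{p₀} and satisfies [W]_{A_{p₀}} ≤ [u·w]_{A₁}^{(p−p₀)/(p−1)}·[w]_{A_p}^{(p₀−1)/(p−1)}. -/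
open MeasureTheory Set Filter ENNReal

noncomputable section

lemma cube_vol_pos {n : ℕ} {Q : Set (Fin n → ℝ)} (hQ : IsCube Q) : volume Q ≠ 0 := by
  obtain ⟨a, r, hr, rfl⟩ := hQ
  rw [Real.volume_Icc_pi, Finset.prod_ne_zero_iff]
  intro i _
  simp [hr]

lemma cube_compact {n : ℕ} {Q : Set (Fin n → ℝ)} (hQ : IsCube Q) : IsCompact Q := by
  obtain ⟨a, r, hr, rfl⟩ := hQ
  exact isCompact_Icc

lemma avg_ne_top {n : ℕ} {Q : Set (Fin n → ℝ)} (hQ : IsCube Q) {f : (Fin n → ℝ) → ℝ}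
    (hf : IsWeight f) : avg Q f ≠ ⊤ := by
  have h1 : IntegrableOn f Q := hf.2.integrableOn_isCompact (cube_compact hQ)
  exact ENNReal.div_ne_top h1.lintegral_lt_top.ne (cube_vol_pos hQ)

lemma avg_ne_zero {n : ℕ} {Q : Set (Fin n → ℝ)} (hQ : IsCube Q) {f : (Fin n → ℝ) → ℝ}
    (hf : IsWeight f) : avg Q f ≠ 0 := by
  unfold avg
  rw [Ne, ENNReal.div_eq_zero_iff, not_or]
  refine ⟨?_, (cube_compact hQ).measure_lt_top.ne⟩
  rw [lintegral_eq_zero_iff' (hf.2.aestronglyMeasurable.aemeasurable.ennreal_ofReal.restrict)]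
  intro h
  have h2 := ae_restrict_of_ae (s := Q) hf.1
  have h3 : ∀ᵐ x ∂(volume.restrict Q), False := by
    filter_upwards [h, h2] with x h h2
    simp at h; linarith
  rw [Filter.eventually_false_iff_eq_bot, ae_eq_bot, Measure.restrict_eq_zero] at h3
  exact cube_vol_pos hQ h3

lemma avg_holder {n : ℕ} {Q : Set (Fin n → ℝ)} (hQ : IsCube Q) {f g h : (Fin n → ℝ) → ℝ}
    (hf : IsWeight f) (hg : IsWeight g) {s t : ℝ} (hs : 0 ≤ s) (ht : 0 ≤ t) (hst : s + t = 1)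
    (hh : ∀ᵐ x ∂(volume : Measure (Fin n → ℝ)), h x = f x ^ s * g x ^ t) :
    avg Q h ≤ avg Q f ^ s * avg Q g ^ t := by
  unfold avg
  rw [ENNReal.div_rpow_of_nonneg _ _ hs, ENNReal.div_rpow_of_nonneg _ _ ht]
  have hV0 := cube_vol_pos hQ
  have hVt : volume Q ≠ ⊤ := (cube_compact hQ).measure_lt_top.ne
  have hV : volume Q = volume Q ^ s * volume Q ^ t := by
    rw [← ENNReal.rpow_add _ _ hV0 hVt, hst, ENNReal.rpow_one]
  have hi : (volume Q)⁻¹ = (volume Q ^ s)⁻¹ * (volume Q ^ t)⁻¹ := by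
    rw [← ENNReal.mul_inv, ← hV]
    · right; exact ENNReal.rpow_ne_top_of_nonneg ht hVt
    · left; exact ENNReal.rpow_ne_top_of_nonneg hs hVt
  rw [div_eq_mul_inv, div_eq_mul_inv, div_eq_mul_inv, hi, mul_mul_mul_comm]
  gcongr
  have e : ∫⁻ x in Q, ENNReal.ofReal (h x)
      = ∫⁻ x in Q, ENNReal.ofReal (f x) ^ s * ENNReal.ofReal (g x) ^ t := by
    apply lintegral_congr_ae
    filter_upwards [ae_restrict_of_ae (s := Q) hf.1, ae_restrict_of_ae (s := Q) hg.1,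
      ae_restrict_of_ae (s := Q) hh] with x h1 h2 h3
    rw [h3, ENNReal.ofReal_mul (by positivity), ENNReal.ofReal_rpow_of_pos h1,
      ENNReal.ofReal_rpow_of_pos h2]
  rw [e]
  exact ENNReal.lintegral_mul_norm_pow_le
    (hf.2.aestronglyMeasurable.aemeasurable.ennreal_ofReal.restrict)
    (hg.2.aestronglyMeasurable.aemeasurable.ennreal_ofReal.restrict) hs ht hst

lemma avg_le_const {n : ℕ} {Q : Set (Fin n → ℝ)} {f g : (Fin n → ℝ) → ℝ} {k : ℝ} (hk : 0 ≤ k)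
    (h : ∀ᵐ x ∂(volume.restrict Q), f x ≤ k * g x) :
    avg Q f ≤ ENNReal.ofReal k * avg Q g := by
  unfold avg
  rw [← mul_div_assoc, ← lintegral_const_mul' _ _ ENNReal.ofReal_ne_top]
  gcongr 1
  apply lintegral_mono_ae
  filter_upwards [h] with x h
  rw [← ENNReal.ofReal_mul hk]
  exact ENNReal.ofReal_le_ofReal h

lemma key {n : ℕ} {p p₀ : ℝ} (hp₀ : 1 < p₀) (hp₀p : p₀ < p)
    {w u : (Fin n → ℝ) → ℝ} (hw : IsWeight w)
    (hu_pos : ∀ᵐ x ∂(volume : Measure (Fin n → ℝ)), 0 < u x)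
    (huw : IsWeight (fun x => u x * w x)) {c : ℝ}
    (hc : ∀ᵐ x ∂(volume : Measure (Fin n → ℝ)),
      maximalE (fun x => u x * w x) x ≤ ENNReal.ofReal (c * (u x * w x))) :
    0 < c ∧ apCharE p₀ (fun x => u x ^ ((p - p₀) / (p - 1)) * w x)
      ≤ ENNReal.ofReal c ^ ((p - p₀) / (p - 1)) * apCharE p w ^ ((p₀ - 1) / (p - 1)) := by
  -- average bounded by `c u w` on cubes
  have hb : ∀ Q : Set (Fin n → ℝ), IsCube Q → ∀ᵐ x ∂(volume.restrict Q),
      0 < u x ∧ 0 < w x ∧ avg Q (fun x => u x * w x) ≤ ENNReal.ofReal (c * (u x * w x)) := by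
    intro Q hQ
    filter_upwards [ae_restrict_of_ae (s := Q) hc, ae_restrict_of_ae (s := Q) hu_pos,
      ae_restrict_of_ae (s := Q) hw.1, ae_restrict_mem (cube_compact hQ).measurableSet]
      with x h1 h2 h3 h4
    refine ⟨h2, h3, le_trans ?_ h1⟩
    have : avg Q (fun x => u x * w x) ≤ avg Q (fun x => |u x * w x|) := by
      unfold avg
      gcongr with x
      exact le_abs_self _
    refine this.trans ?_
    unfold maximalE
    exact le_iSup₂_of_le Q hQ (le_iSup_of_le h4 le_rfl)
  have hA0 : ∀ Q : Set (Fin n → ℝ), IsCube Q → 0 < (avg Q (fun x => u x * w x)).toReal :=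
    fun Q hQ => ENNReal.toReal_pos (avg_ne_zero hQ huw) (avg_ne_top hQ huw)
  have hb' : ∀ Q : Set (Fin n → ℝ), IsCube Q → ∀ᵐ x ∂(volume.restrict Q),
      0 < u x ∧ 0 < w x ∧ (avg Q (fun x => u x * w x)).toReal ≤ c * (u x * w x) := by
    intro Q hQ
    filter_upwards [hb Q hQ] with x ⟨h1, h2, h3⟩
    refine ⟨h1, h2, ?_⟩
    have h4 : 0 < ENNReal.ofReal (c * (u x * w x)) :=
      lt_of_lt_of_le (pos_iff_ne_zero.2 (avg_ne_zero hQ huw)) h3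
    have h5 : 0 < c * (u x * w x) := ENNReal.ofReal_pos.1 h4
    exact ENNReal.toReal_le_of_le_ofReal h5.le h3
  have hcpos : 0 < c := by
    have hQ : IsCube (Set.Icc (0 : Fin n → ℝ) (fun i => (0 : Fin n → ℝ) i + 1)) :=
      ⟨0, 1, one_pos, rfl⟩
    have : (ae (volume.restrict
        (Set.Icc (0 : Fin n → ℝ) (fun i => (0 : Fin n → ℝ) i + 1)))).NeBot := by
      rw [ae_neBot, Ne, Measure.restrict_eq_zero]
      exact cube_vol_pos hQ
    obtain ⟨x, h1, h2, h3⟩ := (hb' _ hQ).exists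
    have := lt_of_lt_of_le (hA0 _ hQ) h3
    exact pos_of_mul_pos_left this (by positivity)
  refine ⟨hcpos, ?_⟩
  have q1 : 0 < p - 1 := by linarith
  have q2 : 0 < p₀ - 1 := by linarith
  set s := (p - p₀) / (p - 1) with hs
  set t := (p₀ - 1) / (p - 1) with ht
  have hs0 : 0 < s := div_pos (by linarith) q1
  have ht0 : 0 < t := div_pos q2 q1
  have hst : s + t = 1 := by rw [hs, ht]; field_simp; ring
  have htp : t * (1 / (p₀ - 1)) = 1 / (p - 1) := by rw [ht]; field_simp
  have htp' : (p - 1) * t = p₀ - 1 := by rw [ht]; field_simp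
  unfold apCharE
  refine iSup₂_le fun Q hQ => ?_
  set A := avg Q (fun x => u x * w x) with hA
  set B := avg Q w
  set D := avg Q (fun x => w x ^ (-(1 / (p - 1))))
  have hA0 := hA0 Q hQ
  rw [← hA] at hA0
  have hAz : A ≠ 0 := avg_ne_zero hQ huw
  have hAt : A ≠ ⊤ := avg_ne_top hQ huw
  have e1 : avg Q (fun x => u x ^ s * w x) ≤ A ^ s * B ^ t := by
    apply avg_holder hQ huw hw hs0.le ht0.le hst
    filter_upwards [hu_pos, hw.1] with x h1 h2
    rw [Real.mul_rpow h1.le h2.le, mul_assoc, ← Real.rpow_add h2, hst, Real.rpow_one]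
  have e2 : avg Q (fun x => (u x ^ s * w x) ^ (-(1 / (p₀ - 1))))
      ≤ ENNReal.ofReal ((A.toReal / c) ^ (-(s * (1 / (p₀ - 1))))) * D := by
    apply avg_le_const (by positivity)
    filter_upwards [hb' Q hQ] with x ⟨h1, h2, h3⟩
    have e : (u x ^ s * w x) ^ (-(1 / (p₀ - 1)))
        = (u x * w x) ^ (-(s * (1 / (p₀ - 1)))) * w x ^ (-(1 / (p - 1))) := by
      rw [Real.mul_rpow (by positivity) h2.le, Real.mul_rpow h1.le h2.le, ← Real.rpow_mul h1.le,
        mul_assoc, ← Real.rpow_add h2, mul_neg]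
      congr 2
      rw [← htp]
      linear_combination (1 / (p₀ - 1)) * hst
    rw [e]
    gcongr ?_ * _
    apply Real.rpow_le_rpow_of_nonpos (by positivity)
    · rw [div_le_iff₀ hcpos]; linarith
    · have : 0 < s * (1 / (p₀ - 1)) := by positivity
      linarith
  have e3 : ENNReal.ofReal ((A.toReal / c) ^ (-(s * (1 / (p₀ - 1))))) ^ (p₀ - 1)
      = ENNReal.ofReal c ^ s * (A ^ s)⁻¹ := by
    rw [ENNReal.ofReal_rpow_of_pos (by positivity), ← Real.rpow_mul (by positivity)]
    have : -(s * (1 / (p₀ - 1))) * (p₀ - 1) = -s := by field_simp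
    rw [this, Real.rpow_neg (by positivity), ← Real.inv_rpow (by positivity), inv_div,
      ← ENNReal.ofReal_rpow_of_pos (by positivity), ENNReal.ofReal_div_of_pos hA0,
      ENNReal.ofReal_toReal hAt, ENNReal.div_rpow_of_nonneg _ _ hs0.le, div_eq_mul_inv]
  have hAs : A ^ s * (A ^ s)⁻¹ = 1 := by
    apply ENNReal.mul_inv_cancel
    · simp [ENNReal.rpow_eq_zero_iff, hAz, hAt]
    · exact ENNReal.rpow_ne_top_of_nonneg hs0.le hAt
  calc avg Q (fun x => u x ^ s * w x) *
        avg Q (fun x => (u x ^ s * w x) ^ (-(1 / (p₀ - 1)))) ^ (p₀ - 1)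
      ≤ (A ^ s * B ^ t) *
        (ENNReal.ofReal ((A.toReal / c) ^ (-(s * (1 / (p₀ - 1))))) * D) ^ (p₀ - 1) := by
        gcongr
    _ = (A ^ s * B ^ t) * (ENNReal.ofReal c ^ s * (A ^ s)⁻¹ * D ^ (p₀ - 1)) := by
        rw [ENNReal.mul_rpow_of_nonneg _ _ q2.le, e3]
    _ = (A ^ s * (A ^ s)⁻¹) * (ENNReal.ofReal c ^ s * (B ^ t * D ^ (p₀ - 1))) := by ring
    _ = ENNReal.ofReal c ^ s * (B * D ^ (p - 1)) ^ t := by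
        rw [hAs, one_mul, ENNReal.mul_rpow_of_nonneg _ _ ht0.le, ← ENNReal.rpow_mul, htp']
    _ ≤ _ := by
        gcongr
        exact le_iSup₂_of_le Q hQ le_rfl

/-- **Flatness of the auxiliary weight, upward case.** Let `1 < p₀ < p < ∞`, let
`w ∈ A_p`, and let `u` be a positive measurable function with `u·w ∈ A₁`. Then
`W = u^{(p-p₀)/(p-1)}·w` belongs to `A_{p₀}` and
`[W]_{A_{p₀}} ≤ [u·w]_{A₁}^{(p-p₀)/(p-1)} [w]_{A_p}^{(p₀-1)/(p-1)}`. -/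
theorem auxiliary_weight_flat_upward
    (n : ℕ) (p p₀ : ℝ) (hp₀ : 1 < p₀) (hp₀p : p₀ < p)
    (w : (Fin n → ℝ) → ℝ) (hw : MemAp p w)
    (u : (Fin n → ℝ) → ℝ) (hu_meas : Measurable u)
    (hu_pos : ∀ᵐ x ∂(volume : Measure (Fin n → ℝ)), 0 < u x)
    (huw : MemA1 (fun x => u x * w x)) :
    MemAp p₀ (fun x => u x ^ ((p - p₀) / (p - 1)) * w x) ∧
    apChar p₀ (fun x => u x ^ ((p - p₀) / (p - 1)) * w x)
      ≤ a1Char (fun x => u x * w x) ^ ((p - p₀) / (p - 1)) *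
        apChar p w ^ ((p₀ - 1) / (p - 1)) := by
  have q1 : 0 < p - 1 := by linarith
  have q2 : 0 < p₀ - 1 := by linarith
  obtain ⟨hW, ⟨c, hc⟩⟩ := huw
  obtain ⟨hcp, hk⟩ := key hp₀ hp₀p hw.1 hu_pos hW hc
  have hs0 : 0 < (p - p₀) / (p - 1) := div_pos (by linarith) q1
  have hs1 : (p - p₀) / (p - 1) ≤ 1 := by rw [div_le_one q1]; linarith
  have ht0 : 0 < (p₀ - 1) / (p - 1) := div_pos q2 q1
  have hKt : apCharE p w ^ ((p₀ - 1) / (p - 1)) ≠ ⊤ :=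
    ENNReal.rpow_ne_top_of_nonneg ht0.le hw.2
  refine ⟨⟨⟨?_, ?_⟩, ?_⟩, ?_⟩
  · filter_upwards [hu_pos, hw.1.1] with x h1 h2
    positivity
  · refine (hw.1.2.add hW.2).mono ?_ ?_
    · exact (hu_meas.pow_const _).aestronglyMeasurable.mul hw.1.2.aestronglyMeasurable
    · filter_upwards [hu_pos, hw.1.1] with x h1 h2
      have h3 : u x ^ ((p - p₀) / (p - 1)) ≤ 1 + u x := by
        rcases le_total (u x) 1 with h | h
        · have := Real.rpow_le_one h1.le h hs0.le
          linarith
        · have := Real.rpow_le_rpow_of_exponent_le h hs1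
          rw [Real.rpow_one] at this
          linarith
      rw [Real.norm_of_nonneg (by positivity), Real.norm_of_nonneg (by
        simp only [Pi.add_apply]; positivity)]
      simp only [Pi.add_apply]
      nlinarith
  · refine ne_top_of_le_ne_top ?_ hk
    exact ENNReal.mul_ne_top (ENNReal.rpow_ne_top_of_nonneg hs0.le ENNReal.ofReal_ne_top) hKt
  · have hcl : IsClosed {c : ℝ | apChar p₀ (fun x => u x ^ ((p - p₀) / (p - 1)) * w x)
        ≤ c ^ ((p - p₀) / (p - 1)) * apChar p w ^ ((p₀ - 1) / (p - 1))} :=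
      isClosed_le continuous_const ((Real.continuous_rpow_const hs0.le).mul continuous_const)
    refine closure_minimal ?_ hcl (csInf_mem_closure ⟨c, hc⟩ ⟨0, fun d hd =>
      (key hp₀ hp₀p hw.1 hu_pos hW hd).1.le⟩)
    intro d hd
    obtain ⟨hdp, hk⟩ := key hp₀ hp₀p hw.1 hu_pos hW hd
    have := ENNReal.toReal_mono (ENNReal.mul_ne_top
      (ENNReal.rpow_ne_top_of_nonneg hs0.le ENNReal.ofReal_ne_top) hKt) hk
    rw [ENNReal.toReal_mul, ← ENNReal.toReal_rpow, ← ENNReal.toReal_rpow,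
      ENNReal.toReal_ofReal hdp.le] at this
    exact this
end
end

section
/- (Dual average bound in the upward case) Let 1 < p₀ < p < ∞, write p' = p/(p−1) and p₀' = p₀/(p₀−1). Let w be a weight on ℝⁿ and let u be a positive measurable function such that u·w is an A₁ weight. Then for every cube Q ⊂ ℝⁿ, (|Q|⁻¹∫_Q u(x)^{−(p−p₀)/((p−1)(p₀−1))}·w(x)^{1−p₀'} dx)^{p₀−1} ≤ [u·w]_{A₁}^{(p−p₀)/(p−1)} · (|Q|⁻¹∫_Q u(x)·w(x) dx)^{−(p−p₀)/(p−1)} · (|Q|⁻¹∫_Q w(x)^{1−p'} dx)^{p₀−1}. -/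
open MeasureTheory Set Filter ENNReal

noncomputable section

/-- The infimum defining the `A₁` characteristic is attained. -/
lemma a1_attained {n : ℕ} (U : (Fin n → ℝ) → ℝ) (hU : MemA1 U)
    (Q : Set (Fin n → ℝ)) (hA : 0 < avg Q U) (hQ : IsCube Q) (hQ0 : volume Q ≠ 0) :
    ∀ᵐ x ∂(volume : Measure (Fin n → ℝ)), maximalE U x ≤ ENNReal.ofReal (a1Char U * U x) := by
  obtain ⟨⟨hpos, hint⟩, c0, hc0⟩ := hU
  set S : Set ℝ := { c : ℝ | ∀ᵐ x ∂(volume : Measure (Fin n → ℝ)),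
    maximalE U x ≤ ENNReal.ofReal (c * U x) } with hS
  have hbdd : BddBelow S := by
    refine ⟨0, fun c hc => ?_⟩
    by_contra hneg
    push Not at hneg
    apply hQ0
    have hae : ∀ᵐ x ∂(volume : Measure (Fin n → ℝ)), x ∉ Q := by
      filter_upwards [hc, hpos] with x hx hx0 hxQ
      have h1 : avg Q (fun y => |U y|) ≤ maximalE U x :=
        le_iSup_of_le Q (le_iSup_of_le hQ (le_iSup_of_le hxQ le_rfl))
      have h2 : avg Q U ≤ avg Q (fun y => |U y|) := by
        unfold avg
        gcongr with y
        exact le_abs_self _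
      have h3 : ENNReal.ofReal (c * U x) = 0 :=
        ENNReal.ofReal_of_nonpos (mul_nonpos_of_nonpos_of_nonneg hneg.le hx0.le)
      rw [h3] at hx
      exact absurd hA (not_lt.mpr (h2.trans (h1.trans hx)))
    simpa [ae_iff] using hae
  obtain ⟨v, -, hv, hvS⟩ := exists_seq_tendsto_sInf (S := S) ⟨c0, hc0⟩ hbdd
  have hall : ∀ᵐ x ∂(volume : Measure (Fin n → ℝ)), ∀ k, maximalE U x ≤ ENNReal.ofReal (v k * U x) :=
    ae_all_iff.mpr hvS
  filter_upwards [hall] with x hx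
  exact ge_of_tendsto' (ENNReal.tendsto_ofReal (hv.mul_const (U x))) hx

/-- **Dual average bound in the upward case.** Let `1 < p₀ < p < ∞`, `p' = p/(p-1)`,
`p₀' = p₀/(p₀-1)`. Let `w` be a weight and `u` a positive measurable function with
`u·w ∈ A₁`. Then for every cube `Q ⊂ ℝⁿ`,
`(|Q|⁻¹∫_Q u^{-(p-p₀)/((p-1)(p₀-1))} w^{1-p₀'})^{p₀-1}
  ≤ [u·w]_{A₁}^{(p-p₀)/(p-1)} (|Q|⁻¹∫_Q u·w)^{-(p-p₀)/(p-1)} (|Q|⁻¹∫_Q w^{1-p'})^{p₀-1}`. -/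
theorem dual_average_bound_upward
    (n : ℕ) (p p₀ : ℝ) (hp₀ : 1 < p₀) (hp₀p : p₀ < p)
    (w : (Fin n → ℝ) → ℝ) (hw : IsWeight w)
    (u : (Fin n → ℝ) → ℝ) (hu_meas : Measurable u)
    (hu_pos : ∀ᵐ x ∂(volume : Measure (Fin n → ℝ)), 0 < u x)
    (huw : MemA1 (fun x => u x * w x))
    (Q : Set (Fin n → ℝ)) (hQ : IsCube Q) :
    (avg Q (fun x =>
        u x ^ (-((p - p₀) / ((p - 1) * (p₀ - 1)))) * w x ^ (1 - p₀ / (p₀ - 1))))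
      ^ (p₀ - 1)
      ≤ ENNReal.ofReal (a1Char (fun x => u x * w x) ^ ((p - p₀) / (p - 1))) *
        avg Q (fun x => u x * w x) ^ (-((p - p₀) / (p - 1))) *
        (avg Q (fun x => w x ^ (1 - p / (p - 1)))) ^ (p₀ - 1) := by
  obtain ⟨⟨hUpos, hUint⟩, -⟩ := id huw
  have hQc : IsCompact Q := by
    obtain ⟨a, r, hr, rfl⟩ := hQ
    exact isCompact_Icc
  have hQm : MeasurableSet Q := hQc.measurableSet
  have hQ0 : volume Q ≠ 0 := by
    obtain ⟨a, r, hr, rfl⟩ := hQ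
    rw [Real.volume_Icc_pi]
    simp [hr]
  have hQt : volume Q ≠ ⊤ := hQc.measure_ne_top
  have hI := hUint.integrableOn_isCompact hQc
  set U : (Fin n → ℝ) → ℝ := fun x => u x * w x with hUdef
  have hA0 : 0 < avg Q U := by
    unfold avg
    refine ENNReal.div_pos ?_ hQt
    intro h0
    rw [lintegral_eq_zero_iff' hI.aestronglyMeasurable.aemeasurable.ennreal_ofReal] at h0
    apply hQ0
    have : ∀ᵐ x ∂(volume.restrict Q), False := by
      filter_upwards [h0, ae_restrict_of_ae hUpos] with x hx hx0
      have : ENNReal.ofReal (U x) = 0 := hx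
      rw [ENNReal.ofReal_eq_zero] at this
      linarith
    simpa [ae_iff] using this
  have hAt : avg Q U ≠ ⊤ := by
    unfold avg
    refine ENNReal.div_ne_top ?_ hQ0
    exact (hI.lintegral_lt_top).ne
  have hmax := a1_attained U huw Q hA0 hQ hQ0
  set C := a1Char U with hC
  set a := (avg Q U).toReal with ha
  have ha0 : 0 < a := ENNReal.toReal_pos hA0.ne' hAt
  have hAa : avg Q U = ENNReal.ofReal a := (ENNReal.ofReal_toReal hAt).symm
  have hkey : ∀ᵐ x ∂(volume.restrict Q), a ≤ C * U x := by
    filter_upwards [ae_restrict_of_ae hmax, ae_restrict_mem hQm] with x hx hxQ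
    have h1 : avg Q (fun y => |U y|) ≤ maximalE U x :=
      le_iSup_of_le Q (le_iSup_of_le hQ (le_iSup_of_le hxQ le_rfl))
    have h2 : avg Q U ≤ avg Q (fun y => |U y|) := by
      unfold avg
      gcongr with y
      exact le_abs_self _
    have h3 := h2.trans (h1.trans hx)
    rw [hAa] at h3
    by_contra hlt
    push Not at hlt
    exact absurd h3 (not_le.mpr ((ENNReal.ofReal_lt_ofReal_iff ha0).mpr hlt))
  have hC0 : 0 < C := by
    by_contra hneg
    push Not at hneg
    apply hQ0
    have : ∀ᵐ x ∂(volume.restrict Q), False := by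
      filter_upwards [hkey, ae_restrict_of_ae hUpos] with x hx hx0
      have := mul_nonpos_of_nonpos_of_nonneg hneg hx0.le
      linarith
    simpa [ae_iff] using this
  have hp1 : 0 < p - 1 := by linarith
  have hq1 : 0 < p₀ - 1 := by linarith
  set s := (p - p₀) / ((p - 1) * (p₀ - 1)) with hs
  have hs0 : 0 < s := div_pos (by linarith) (mul_pos hp1 hq1)
  have hst : (p - p₀) / (p - 1) = s * (p₀ - 1) := by
    rw [hs]; field_simp
  have hexp : 1 - p₀ / (p₀ - 1) = -s + (1 - p / (p - 1)) := by
    rw [hs]; field_simp; ring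
  have hmain : avg Q (fun x => u x ^ (-s) * w x ^ (1 - p₀ / (p₀ - 1)))
      ≤ ENNReal.ofReal ((a / C) ^ (-s)) * avg Q (fun x => w x ^ (1 - p / (p - 1))) := by
    unfold avg
    rw [← mul_div_assoc, ← lintegral_const_mul' _ _ ENNReal.ofReal_ne_top]
    refine ENNReal.div_le_div_right (lintegral_mono_ae ?_) _
    filter_upwards [hkey, ae_restrict_of_ae hu_pos, ae_restrict_of_ae hw.1] with x hx hux hwx
    rw [← ENNReal.ofReal_mul (by positivity)]
    apply ENNReal.ofReal_le_ofReal
    rw [hexp, Real.rpow_add hwx, ← mul_assoc, ← Real.mul_rpow hux.le hwx.le]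
    refine mul_le_mul_of_nonneg_right ?_ (Real.rpow_nonneg hwx.le _)
    refine Real.rpow_le_rpow_of_nonpos (div_pos ha0 hC0) ?_ (by linarith)
    rw [div_le_iff₀ hC0, mul_comm]
    exact hx
  calc _ ≤ (ENNReal.ofReal ((a / C) ^ (-s)) * avg Q (fun x => w x ^ (1 - p / (p - 1)))) ^ (p₀ - 1) :=
        ENNReal.rpow_le_rpow hmain hq1.le
    _ = _ := by
      rw [ENNReal.mul_rpow_of_nonneg _ _ hq1.le, hAa, hst, ENNReal.ofReal_rpow_of_pos ha0,
        ENNReal.ofReal_rpow_of_pos (by positivity), ← ENNReal.ofReal_mul (by positivity),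
        ← Real.rpow_mul (by positivity), Real.div_rpow ha0.le hC0.le, neg_mul,
        Real.rpow_neg hC0.le, div_inv_eq_mul, mul_comm (a ^ _)]
end
end
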